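/- Let d ∈ ℕ, 0 < θ ≤ ∞, 2 ≤ q ≤ ∞ and r > (1 − 1/θ)_+. Then there is a constant C > 0 such that ρ_m(S^r_θ A)_{L_q} ≤ C · m^{−(r + 1/θ + 1/q − 1)} · (log* m)^{(d−1)r + 3(r + 1/θ + 1/q − 1)} for all m ∈ ℕ. -/

import Mathlib

open MeasureTheory Real ENNReal

noncomputable section

namespace Paper

/-- The fundamental domain `[0,1)^d` of the `d`-dimensional torus `𝕋^d`. -/
def cube (d : ℕ) : Set (Fin d → ℝ) := Set.univ.pi fun _ => Set.Ico (0:ℝ) 1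

/-- The trigonometric character `x ↦ e^{2π i k·x}`. -/
def expk (d : ℕ) (k : Fin d → ℤ) (x : Fin d → ℝ) : ℂ :=
  Complex.exp (((2 * Real.pi * ∑ i, (k i : ℝ) * x i : ℝ) : ℂ) * Complex.I)

/-- Fourier coefficient `f̂(k) = ∫_{[0,1)^d} f(x) e^{-2π i k·x} dx`. -/
def fCoeff (d : ℕ) (f : (Fin d → ℝ) → ℂ) (k : Fin d → ℤ) : ℂ :=
  ∫ x in cube d, f x * expk d (-k) x

/-- The `L_q` (quasi-)norm on the torus, `q ∈ (0,∞]`, valued in `ℝ≥0∞`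
(for `q = ∞` this is the essential supremum). -/
def LqNorm (d : ℕ) (q : ℝ≥0∞) (f : (Fin d → ℝ) → ℂ) : ℝ≥0∞ :=
  eLpNorm f q (volume.restrict (cube d))

/-- The weight `∏_{i=1}^d (1+|k_i|)`. -/
def wt (d : ℕ) (k : Fin d → ℤ) : ℝ := ∏ i, (1 + |(k i : ℝ)|)

/-- The weighted Wiener (quasi-)norm `‖f‖_{S^r_θ A}`
(with the sup modification for `θ = ∞`); `A_θ` corresponds to `r = 0`,
the Wiener algebra `A` to `r = 0`, `θ = 1`. -/
def wienerNorm (d : ℕ) (r : ℝ) (θ : ℝ≥0∞) (f : (Fin d → ℝ) → ℂ) : ℝ≥0∞ :=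
  if θ = ∞ then ⨆ k : Fin d → ℤ, ENNReal.ofReal (wt d k ^ r) * (‖fCoeff d f k‖₊ : ℝ≥0∞)
  else (∑' k : Fin d → ℤ,
      (ENNReal.ofReal (wt d k ^ r) * (‖fCoeff d f k‖₊ : ℝ≥0∞)) ^ θ.toReal) ^ (1 / θ.toReal)

/-- Trigonometric polynomials with at most `m` terms. -/
def trigPoly (d m : ℕ) : Set ((Fin d → ℝ) → ℂ) :=
  {s | ∃ (Λ : Finset (Fin d → ℤ)) (a : (Fin d → ℤ) → ℂ),
    Λ.card ≤ m ∧ s = fun x => ∑ k ∈ Λ, a k * expk d k x}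

/-- Best `m`-term trigonometric approximation error of `f`, error measured by `X`. -/
def sigmaF (d m : ℕ) (X : ((Fin d → ℝ) → ℂ) → ℝ≥0∞) (f : (Fin d → ℝ) → ℂ) : ℝ≥0∞ :=
  ⨅ s ∈ trigPoly d m, X (f - s)

/-- The unit ball of the space (inside `L₁(𝕋^d)`) with (quasi-)norm `N`. -/
def unitBall (d : ℕ) (N : ((Fin d → ℝ) → ℂ) → ℝ≥0∞) : Set ((Fin d → ℝ) → ℂ) :=
  {f | IntegrableOn f (cube d) ∧ N f ≤ 1}

/-- Best `m`-term trigonometric width of the unit ball of `N`, error measured by `X`. -/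
def sigmaClass (d m : ℕ) (N X : ((Fin d → ℝ) → ℂ) → ℝ≥0∞) : ℝ≥0∞ :=
  ⨆ f ∈ unitBall d N, sigmaF d m X f

/-- `log*(m) = max (log₂ m) 1`. -/
def logStar (m : ℕ) : ℝ := max (Real.logb 2 m) 1

/-- Two-sided asymptotic equivalence `a_m ≍ b_m`. -/
def IsAsympEquiv (a : ℕ → ℝ≥0∞) (b : ℕ → ℝ) : Prop :=
  ∃ c C : ℝ, 0 < c ∧ 0 < C ∧ ∃ m₀ : ℕ, ∀ m : ℕ, m₀ ≤ m →
    ENNReal.ofReal (c * b m) ≤ a m ∧ a m ≤ ENNReal.ofReal (C * b m)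

/-- One-sided asymptotic bound `a_m ≲ b_m`. -/
def IsAsympLe (a : ℕ → ℝ≥0∞) (b : ℕ → ℝ) : Prop :=
  ∃ C : ℝ, 0 < C ∧ ∃ m₀ : ℕ, ∀ m : ℕ, m₀ ≤ m → a m ≤ ENNReal.ofReal (C * b m)

/-- Dyadic block `I_0 = {0}`, `I_n = {k : 2^{n-1} ≤ |k| < 2^n}` for `n ≥ 1`. -/
def blockF (n : ℕ) : Finset ℤ :=
  (Finset.Icc (-(2^n : ℤ)) (2^n)).filter fun k =>
    (n = 0 ∧ k = 0) ∨ (n ≠ 0 ∧ 2^(n-1) ≤ |k| ∧ |k| < 2^n)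

/-- The dyadic block projection `∑_{k ∈ I_j} f̂(k) e^{2π i k·x}`. -/
def blockProj (d : ℕ) (f : (Fin d → ℝ) → ℂ) (j : Fin d → ℕ) : (Fin d → ℝ) → ℂ :=
  fun x => ∑ k ∈ Fintype.piFinset (fun i => blockF (j i)), fCoeff d f k * expk d k x

/-- The mixed-smoothness Besov (quasi-)norm `‖f‖_{S^s_{p,θ}B}`
(with the sup modification for `θ = ∞`). -/
def besovNorm (d : ℕ) (s : ℝ) (p θ : ℝ≥0∞) (f : (Fin d → ℝ) → ℂ) : ℝ≥0∞ :=
  if θ = ∞ then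
    ⨆ j : Fin d → ℕ,
      ENNReal.ofReal ((2:ℝ) ^ (((∑ i, j i : ℕ) : ℝ) * s)) * LqNorm d p (blockProj d f j)
  else
    (∑' j : Fin d → ℕ,
      (ENNReal.ofReal ((2:ℝ) ^ (((∑ i, j i : ℕ) : ℝ) * s)) * LqNorm d p (blockProj d f j))
        ^ θ.toReal) ^ (1 / θ.toReal)

/-- The mixed-smoothness Sobolev norm `‖f‖_{S^s_p W}` (Littlewood–Paley form),
with `S^0_p W := L_p`. -/
def sobolevNorm (d : ℕ) (s : ℝ) (p : ℝ≥0∞) (f : (Fin d → ℝ) → ℂ) : ℝ≥0∞ :=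
  if s = 0 then LqNorm d p f
  else
    (∫⁻ x in cube d,
      ((∑' j : Fin d → ℕ,
        (ENNReal.ofReal ((2:ℝ) ^ (((∑ i, j i : ℕ) : ℝ) * s)) *
          (‖blockProj d f j x‖₊ : ℝ≥0∞)) ^ (2:ℕ)) ^ ((1:ℝ)/2)) ^ p.toReal) ^ (1 / p.toReal)

/-- Trigonometric polynomials with frequencies in `[-M,M]^d`. -/
def boxPoly (d M : ℕ) : Set ((Fin d → ℝ) → ℂ) :=
  {s | ∃ (Λ : Finset (Fin d → ℤ)) (a : (Fin d → ℤ) → ℂ),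
    (∀ k ∈ Λ, ∀ i, |k i| ≤ (M : ℤ)) ∧ s = fun x => ∑ k ∈ Λ, a k * expk d k x}

/-- Error of best approximation by trigonometric polynomials with
frequencies in `[-M,M]^d`, measured in `L_∞`. -/
def EBox (d M : ℕ) (f : (Fin d → ℝ) → ℂ) : ℝ≥0∞ :=
  ⨅ g ∈ boxPoly d M, LqNorm d ∞ (f - g)

/-- The `m`-th (non-linear) sampling width of the class of continuous functions
in the unit ball of `N`, error measured in `L_q`. -/
def samplingWidth (d m : ℕ) (N : ((Fin d → ℝ) → ℂ) → ℝ≥0∞) (q : ℝ≥0∞) : ℝ≥0∞ :=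
  ⨅ (t : Fin m → (Fin d → ℝ)) (_ : ∀ i, t i ∈ cube d)
    (R : (Fin m → ℂ) → ((Fin d → ℝ) → ℂ)),
    ⨆ f ∈ {f : (Fin d → ℝ) → ℂ | Continuous f ∧ N f ≤ 1},
      LqNorm d q (f - R fun i => f (t i))



theorem exp_le_one_add_add_sq {x : ℝ} (hx : |x| ≤ 1) : Real.exp x ≤ 1 + x + x ^ 2 := by
  have := (abs_le.1 (Real.abs_exp_sub_one_sub_id_le hx)).2
  linarith

/-- A convex combination of vectors that are bounded by `1` can be replaced by an empirical average
with controlled one-sided exponential deviations. -/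
theorem exists_tuple_sum_exp_le {ι X : Type*} [Fintype ι] [Fintype X] (p : ι → ℝ)
    (hp : ∀ i, 0 ≤ p i) (hsum : ∑ i, p i = 1) (y : ι → X → ℝ) (hy : ∀ i x, |y i x| ≤ 1)
    {lam : ℝ} (h0 : 0 ≤ lam) (h1 : 2 * lam ≤ 1) (s : ℕ) :
    ∃ v : Fin s → ι,
      ∑ x, Real.exp (lam * (∑ j, y (v j) x - s * ∑ i, p i * y i x)) ≤
        Fintype.card X * Real.exp (4 * lam ^ 2 * s) := by
  induction s with
  | zero => exact ⟨Fin.elim0, by simp⟩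
  | succ s ih =>
    obtain ⟨v, hv⟩ := ih
    set m : X → ℝ := fun x => ∑ i, p i * y i x with hm
    have hmabs : ∀ x, |m x| ≤ 1 := by
      intro x
      calc |m x| ≤ ∑ i, |p i * y i x| := Finset.abs_sum_le_sum_abs _ _
        _ ≤ ∑ i, p i := by
            refine Finset.sum_le_sum fun i _ => ?_
            rw [abs_mul, abs_of_nonneg (hp i)]
            exact mul_le_of_le_one_right (hp i) (hy i x)
        _ = 1 := hsum
    set E : X → ℝ := fun x => Real.exp (lam * (∑ j, y (v j) x - s * m x)) with hE
    have key : ∀ x, ∑ i, p i * Real.exp (lam * (y i x - m x)) ≤ Real.exp (4 * lam ^ 2) := by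
      intro x
      have hd : ∀ i, |y i x - m x| ≤ 2 := fun i =>
        (abs_sub _ _).trans (by linarith [hy i x, hmabs x])
      calc ∑ i, p i * Real.exp (lam * (y i x - m x))
          ≤ ∑ i, p i * (1 + lam * (y i x - m x) + 4 * lam ^ 2) := by
            refine Finset.sum_le_sum fun i _ => mul_le_mul_of_nonneg_left ?_ (hp i)
            have h2 : |lam * (y i x - m x)| ≤ 1 := by
              rw [abs_mul, abs_of_nonneg h0]
              nlinarith [hd i, abs_nonneg (y i x - m x)]
            have h3 : (y i x - m x) ^ 2 ≤ 4 := by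
              rw [← sq_abs]; nlinarith [hd i, abs_nonneg (y i x - m x)]
            nlinarith [exp_le_one_add_add_sq h2, sq_nonneg lam]
        _ = (∑ i, p i) * (1 + 4 * lam ^ 2) + lam * (∑ i, p i * y i x - (∑ i, p i) * m x) := by
            rw [Finset.sum_mul, Finset.sum_mul, ← Finset.sum_sub_distrib, Finset.mul_sum,
              ← Finset.sum_add_distrib]
            exact Finset.sum_congr rfl fun i _ => by ring
        _ = 1 + 4 * lam ^ 2 := by rw [hsum]; simp [hm]
        _ ≤ Real.exp (4 * lam ^ 2) := by linarith [Real.add_one_le_exp (4 * lam ^ 2)]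
    have avg : ∑ i, p i * ∑ x, E x * Real.exp (lam * (y i x - m x)) ≤
        ∑ i, p i * ((∑ x, E x) * Real.exp (4 * lam ^ 2)) := by
      calc ∑ i, p i * ∑ x, E x * Real.exp (lam * (y i x - m x))
          = ∑ x, E x * ∑ i, p i * Real.exp (lam * (y i x - m x)) := by
            simp_rw [Finset.mul_sum]
            rw [Finset.sum_comm]
            exact Finset.sum_congr rfl fun _ _ => Finset.sum_congr rfl fun _ _ => by ring
        _ ≤ ∑ x, E x * Real.exp (4 * lam ^ 2) :=
            Finset.sum_le_sum fun x _ => mul_le_mul_of_nonneg_left (key x) (Real.exp_pos _).le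
        _ = ∑ i, p i * ((∑ x, E x) * Real.exp (4 * lam ^ 2)) := by
            rw [← Finset.sum_mul, ← Finset.sum_mul, hsum, one_mul]
    have hne : (Finset.univ : Finset ι).Nonempty := by
      by_contra h
      rw [Finset.not_nonempty_iff_eq_empty] at h
      rw [h] at hsum; simp at hsum
    obtain ⟨i, hi⟩ : ∃ i, ∑ x, E x * Real.exp (lam * (y i x - m x)) ≤
        (∑ x, E x) * Real.exp (4 * lam ^ 2) := by
      by_contra hcon
      push Not at hcon
      obtain ⟨i0, -, hi0⟩ : ∃ i ∈ Finset.univ, 0 < p i := by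
        by_contra h
        push Not at h
        have : ∑ i, p i ≤ 0 := Finset.sum_nonpos h
        linarith
      refine absurd avg (not_le.2 (Finset.sum_lt_sum (fun i _ => ?_) ⟨i0, Finset.mem_univ _, ?_⟩))
      · exact mul_le_mul_of_nonneg_left (hcon i).le (hp i)
      · exact mul_lt_mul_of_pos_left (hcon i0) hi0
    refine ⟨Fin.cons i v, ?_⟩
    calc _ = ∑ x, E x * Real.exp (lam * (y i x - m x)) := by
          refine Finset.sum_congr rfl fun x _ => ?_
          rw [hE, ← Real.exp_add, Fin.sum_univ_succ]
          simp only [Fin.cons_zero, Fin.cons_succ]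
          push_cast
          congr 1
          ring
      _ ≤ (∑ x, E x) * Real.exp (4 * lam ^ 2) := hi
      _ ≤ (Fintype.card X * Real.exp (4 * lam ^ 2 * s)) * Real.exp (4 * lam ^ 2) :=
          mul_le_mul_of_nonneg_right hv (Real.exp_pos _).le
      _ = _ := by
          rw [mul_assoc, ← Real.exp_add]
          push_cast
          congr 2
          ring

theorem exists_tuple_sum_sub_le {ι X : Type*} [Fintype ι] [Fintype X] (p : ι → ℝ)
    (hp : ∀ i, 0 ≤ p i) (hsum : ∑ i, p i = 1) (y : ι → X → ℝ) (hy : ∀ i x, |y i x| ≤ 1)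
    {τ : ℝ} (h0 : 0 < τ) (h1 : τ ≤ 4) (s : ℕ)
    (hs : 16 * Real.log (Fintype.card X) ≤ s * τ ^ 2) :
    ∃ v : Fin s → ι, ∀ x, ∑ j, y (v j) x - s * ∑ i, p i * y i x ≤ s * τ := by
  obtain ⟨v, hv⟩ := exists_tuple_sum_exp_le p hp hsum y hy (lam := τ / 8) (by positivity)
    (by linarith) s
  refine ⟨v, fun x => ?_⟩
  set D := ∑ j, y (v j) x - s * ∑ i, p i * y i x with hD
  have hcard : (0 : ℝ) < Fintype.card X := by
    exact_mod_cast Fintype.card_pos_iff.2 ⟨x⟩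
  have h2 : Real.exp (τ / 8 * D) ≤ Fintype.card X * Real.exp (4 * (τ / 8) ^ 2 * s) :=
    le_trans (Finset.single_le_sum (f := fun x => Real.exp (τ / 8 *
      (∑ j, y (v j) x - s * ∑ i, p i * y i x))) (fun _ _ => (Real.exp_pos _).le)
      (Finset.mem_univ x)) hv
  have h3 : τ / 8 * D ≤ Real.log (Fintype.card X) + 4 * (τ / 8) ^ 2 * s := by
    have := Real.log_le_log (Real.exp_pos _) h2
    rwa [Real.log_exp, Real.log_mul hcard.ne' (Real.exp_pos _).ne', Real.log_exp] at this
  have h4 : τ * D ≤ τ * (s * τ) := by nlinarith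
  exact le_of_mul_le_mul_left h4 h0

/-- The atoms `i^c e_k` used in Maurey's empirical method. -/
def atom {J X : Type*} (e : J → X → ℂ) : Option (J × Fin 4) → X → ℂ
  | none, _ => 0
  | some (k, c), x => Complex.I ^ (c : ℕ) * e k x

theorem norm_atom_le {J X : Type*} {e : J → X → ℂ} (he : ∀ k x, ‖e k x‖ ≤ 1)
    (o : Option (J × Fin 4)) (x : X) : ‖atom e o x‖ ≤ 1 := by
  rcases o with _ | ⟨k, c⟩
  · simp [atom]
  · simpa [atom] using he k x

/-- The nonnegative coefficients of a complex number with respect to `1, i, -1, -i`. -/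
def phaseWeight (z : ℂ) : Fin 4 → ℝ := ![max z.re 0, max z.im 0, max (-z.re) 0, max (-z.im) 0]

theorem phaseWeight_nonneg (z : ℂ) (c : Fin 4) : 0 ≤ phaseWeight z c := by
  fin_cases c <;> simp [phaseWeight]

theorem sum_phaseWeight_le (z : ℂ) : ∑ c, phaseWeight z c ≤ 2 * ‖z‖ := by
  have h1 := Complex.abs_re_le_norm z
  have h2 := Complex.abs_im_le_norm z
  have h3 : ∀ t : ℝ, max t 0 + max (-t) 0 = |t| := by
    intro t
    rcases le_total 0 t with h | h
    · rw [max_eq_left h, max_eq_right (by linarith), abs_of_nonneg h, add_zero]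
    · rw [max_eq_right h, max_eq_left (by linarith), abs_of_nonpos h, zero_add]
  simp only [Fin.sum_univ_four, phaseWeight, Matrix.cons_val]
  linarith [h3 z.re, h3 z.im]

theorem sum_phaseWeight_mul (z : ℂ) :
    ∑ c : Fin 4, (phaseWeight z c : ℂ) * Complex.I ^ (c : ℕ) = z := by
  have h3 : ∀ t : ℝ, max t 0 - max (-t) 0 = t := by
    intro t
    rcases le_total 0 t with h | h
    · rw [max_eq_left h, max_eq_right (by linarith), sub_zero]
    · rw [max_eq_right h, max_eq_left (by linarith)]; ring
  have hI : Complex.I ^ 3 = -Complex.I := by rw [pow_succ, Complex.I_sq]; ring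
  have e2 : ((2 : Fin 4) : ℕ) = 2 := rfl
  have e3 : ((3 : Fin 4) : ℕ) = 3 := rfl
  simp only [Fin.sum_univ_four, phaseWeight, Matrix.cons_val, Fin.val_zero, Fin.val_one, e2, e3,
    pow_zero, pow_one, Complex.I_sq, hI]
  have hr : ((max z.re 0 : ℝ) : ℂ) - ((max (-z.re) 0 : ℝ) : ℂ) = z.re := by exact_mod_cast h3 z.re
  have hi : ((max z.im 0 : ℝ) : ℂ) - ((max (-z.im) 0 : ℝ) : ℂ) = z.im := by exact_mod_cast h3 z.im
  linear_combination hr + Complex.I * hi + Complex.re_add_im z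

/-- Maurey's lemma in the supremum norm over a finite set. -/
theorem exists_atom_average {J X : Type*} [Fintype J] [Fintype X] {e : J → X → ℂ}
    (he : ∀ k x, ‖e k x‖ ≤ 1) {A : ℝ} (hA : 0 < A) {a : J → ℂ} (ha : ∑ k, ‖a k‖ ≤ A)
    {τ : ℝ} (h0 : 0 < τ) (h1 : τ ≤ 4) {s : ℕ} (hs0 : 0 < s)
    (hs : 16 * Real.log (4 * Fintype.card X) ≤ s * τ ^ 2) :
    ∃ v : Fin s → Option (J × Fin 4), ∀ x,
      ‖∑ k, a k * e k x - ((2 * A / s : ℝ) : ℂ) * ∑ j, atom e (v j) x‖ ≤ 4 * A * τ := by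
  set w : Option (J × Fin 4) → ℝ := fun o => match o with
    | none => 1 - ∑ k, ∑ c, phaseWeight (a k) c / (2 * A)
    | some (k, c) => phaseWeight (a k) c / (2 * A) with hw
  have hle : ∑ k, ∑ c, phaseWeight (a k) c / (2 * A) ≤ 1 := by
    calc ∑ k, ∑ c, phaseWeight (a k) c / (2 * A) = (∑ k, ∑ c, phaseWeight (a k) c) / (2 * A) := by
          simp_rw [Finset.sum_div]
      _ ≤ (∑ k, 2 * ‖a k‖) / (2 * A) := by
          gcongr with k _
          exact sum_phaseWeight_le _
      _ ≤ 1 := by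
          rw [← Finset.mul_sum, div_le_one (by positivity)]; linarith
  have hw0 : ∀ o, 0 ≤ w o := by
    rintro (_ | ⟨k, c⟩)
    · simpa [hw] using hle
    · exact div_nonneg (phaseWeight_nonneg _ _) (by positivity)
  have hw1 : ∑ o, w o = 1 := by
    rw [Fintype.sum_option, Fintype.sum_prod_type]
    simp [hw]
  have hmean : ∀ x, ∑ o, (w o : ℂ) * atom e o x = (∑ k, a k * e k x) / ((2 * A : ℝ) : ℂ) := by
    intro x
    rw [Fintype.sum_option, Fintype.sum_prod_type]
    simp only [atom, mul_zero, zero_add]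
    rw [Finset.sum_div]
    refine Finset.sum_congr rfl fun k _ => ?_
    conv_rhs => rw [← sum_phaseWeight_mul (a k)]
    rw [Finset.sum_mul, Finset.sum_div]
    refine Finset.sum_congr rfl fun c _ => ?_
    simp only [hw]
    push_cast
    ring
  let y : Option (J × Fin 4) → X × Fin 4 → ℝ := fun o x =>
    (Complex.I ^ (x.2 : ℕ) * atom e o x.1).re
  have hy : ∀ o x, |y o x| ≤ 1 := fun o x =>
    (Complex.abs_re_le_norm _).trans (by simpa using norm_atom_le he o x.1)
  obtain ⟨v, hv⟩ := exists_tuple_sum_sub_le w hw0 hw1 y hy h0 h1 s (by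
    simpa [mul_comm] using hs)
  refine ⟨v, fun x => ?_⟩
  set D : ℂ := ∑ j, atom e (v j) x - s * ((∑ k, a k * e k x) / ((2 * A : ℝ) : ℂ)) with hD
  have hDc : ∀ c : Fin 4, (Complex.I ^ (c : ℕ) * D).re ≤ s * τ := by
    intro c
    refine le_trans (le_of_eq ?_) (hv (x, c))
    rw [hD, mul_sub, Complex.sub_re, Finset.mul_sum, Complex.re_sum, ← hmean x]
    congr 1
    rw [mul_left_comm, ← Complex.ofReal_natCast, Complex.re_ofReal_mul, Finset.mul_sum,
      Complex.re_sum]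
    congr 1
    refine Finset.sum_congr rfl fun o _ => ?_
    rw [mul_left_comm, Complex.re_ofReal_mul]
  have hre : |D.re| ≤ s * τ := by
    have a0 := hDc 0
    have a2 := hDc 2
    simp [Complex.I_sq] at a0 a2
    exact abs_le.2 ⟨by linarith, a0⟩
  have him : |D.im| ≤ s * τ := by
    have a0 := hDc 1
    have a2 := hDc 3
    simp [pow_succ] at a0 a2
    exact abs_le.2 ⟨by linarith, by linarith⟩
  have hs0' : (0 : ℝ) < s := by exact_mod_cast hs0
  have hDn : ‖D‖ ≤ 2 * (s * τ) := (Complex.norm_le_abs_re_add_abs_im D).trans (by linarith)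
  have heq : ∑ k, a k * e k x - ((2 * A / s : ℝ) : ℂ) * ∑ j, atom e (v j) x =
      -(((2 * A / s : ℝ) : ℂ) * D) := by
    have : (s : ℂ) ≠ 0 := by exact_mod_cast hs0.ne'
    have : (A : ℂ) ≠ 0 := by exact_mod_cast hA.ne'
    rw [hD]
    push_cast
    field_simp
    ring
  rw [heq, norm_neg, norm_mul, Complex.norm_real, Real.norm_of_nonneg (by positivity)]
  calc 2 * A / s * ‖D‖ ≤ 2 * A / s * (2 * (s * τ)) := by gcongr
    _ = 4 * A * τ := by field_simp; ring

theorem exists_forall_exists_mem {I X : Type*} [Fintype I] [Fintype X] [DecidableEq X]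
    (G : I → Finset X) (m : ℕ) (h : ∑ i, ((G i)ᶜ.card : ℝ) ^ m < (Fintype.card X : ℝ) ^ m) :
    ∃ t : Fin m → X, ∀ i, ∃ j, t j ∈ G i := by
  classical
  by_contra hcon
  push Not at hcon
  have hsub : (Finset.univ : Finset (Fin m → X)) ⊆
      Finset.univ.biUnion fun i => Fintype.piFinset fun _ : Fin m => (G i)ᶜ := by
    intro t _
    obtain ⟨i, hi⟩ := hcon t
    simp only [Finset.mem_biUnion, Finset.mem_univ, true_and, Fintype.mem_piFinset,
      Finset.mem_compl]
    exact ⟨i, hi⟩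
  have hc := (Finset.card_le_card hsub).trans Finset.card_biUnion_le
  simp only [Finset.card_univ, Fintype.card_pi, Finset.prod_const, Fintype.card_piFinset,
    Fintype.card_fin] at hc
  have hc' : (Fintype.card X : ℝ) ^ m ≤ ∑ i, ((G i)ᶜ.card : ℝ) ^ m := by exact_mod_cast hc
  linarith

theorem sq_le_sum_levels (L : ℕ) {g : ℝ} (h0 : 0 ≤ g) (hg : g < 2 ^ L / 2) :
    g ^ 2 ≤ 1 / 4 + ∑ l ∈ Finset.range L,
      4 * ((2 : ℝ) ^ l / 2) ^ 2 * (if (2 : ℝ) ^ l / 2 ≤ g then 1 else 0) := by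
  induction L with
  | zero => simp at hg ⊢; nlinarith
  | succ L ih =>
    rw [Finset.sum_range_succ]
    by_cases h : (2 : ℝ) ^ L / 2 ≤ g
    · have : 0 ≤ ∑ l ∈ Finset.range L,
          4 * ((2 : ℝ) ^ l / 2) ^ 2 * (if (2 : ℝ) ^ l / 2 ≤ g then (1 : ℝ) else 0) :=
        Finset.sum_nonneg fun l _ => by positivity
      rw [if_pos h]
      rw [pow_succ] at hg
      nlinarith
    · rw [if_neg h]
      have := ih (not_le.1 h)
      linarith

theorem exists_large_level {X : Type*} [Fintype X] (g : X → ℝ) (h0 : ∀ x, 0 ≤ g x) {L : ℕ}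
    (hL : 0 < L) (hg : ∀ x, g x < 2 ^ L / 2) [Nonempty X]
    (hsum : (Fintype.card X : ℝ) ≤ ∑ x, g x ^ 2) :
    ∃ l < L, 3 / (16 * L * ((2 : ℝ) ^ l / 2) ^ 2) * Fintype.card X ≤
      (Finset.univ.filter fun x => (2 : ℝ) ^ l / 2 ≤ g x).card := by
  by_contra hcon
  push Not at hcon
  have hN : (0 : ℝ) < Fintype.card X := by exact_mod_cast Fintype.card_pos
  have hL' : (0 : ℝ) < L := by exact_mod_cast hL
  have h1 : ∑ x, g x ^ 2 ≤ ∑ x, (1 / 4 + ∑ l ∈ Finset.range L,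
      4 * ((2 : ℝ) ^ l / 2) ^ 2 * (if (2 : ℝ) ^ l / 2 ≤ g x then (1 : ℝ) else 0)) :=
    Finset.sum_le_sum fun x _ => sq_le_sum_levels L (h0 x) (hg x)
  rw [Finset.sum_add_distrib, Finset.sum_comm] at h1
  have h2 : ∑ l ∈ Finset.range L, ∑ x : X,
      4 * ((2 : ℝ) ^ l / 2) ^ 2 * (if (2 : ℝ) ^ l / 2 ≤ g x then (1 : ℝ) else 0) <
      ∑ l ∈ Finset.range L, 3 / (4 * L) * (Fintype.card X : ℝ) := by
    refine Finset.sum_lt_sum_of_nonempty (by simpa using hL.ne') fun l hl => ?_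
    rw [← Finset.mul_sum, Finset.sum_boole]
    calc _ < 4 * ((2 : ℝ) ^ l / 2) ^ 2 *
          (3 / (16 * L * ((2 : ℝ) ^ l / 2) ^ 2) * Fintype.card X) :=
          mul_lt_mul_of_pos_left (hcon l (Finset.mem_range.1 hl)) (by positivity)
      _ = _ := by field_simp; ring
  have h3 : ∑ l ∈ Finset.range L, 3 / (4 * L) * (Fintype.card X : ℝ) =
      3 / 4 * Fintype.card X := by
    rw [Finset.sum_const, Finset.card_range, nsmul_eq_mul]; field_simp
  have h4 : ∑ x : X, (1 / 4 : ℝ) = 1 / 4 * Fintype.card X := by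
    rw [Finset.sum_const, Finset.card_univ, nsmul_eq_mul]; ring
  linarith

/-- Existence of sampling points that detect every function of unit `ℓ₂` norm in the span of a
bounded system whose coefficients have `ℓ₁` norm at most `A`. -/
theorem exists_sampling_points {J X : Type*} [Fintype J] [Fintype X] [Nonempty X]
    {e : J → X → ℂ} (he : ∀ k x, ‖e k x‖ ≤ 1) {A : ℝ} (hA : 0 < A) {L : ℕ} (hL : 0 < L)
    (hAL : A < 2 ^ L / 2) {m : ℕ} {Q : ℝ} (hQ1 : 1 ≤ Q) (hQX : Real.log (4 * Fintype.card X) ≤ Q)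
    (hQJ : Real.log (4 * Fintype.card J + 1) ≤ Q) (hQL : Real.log L ≤ Q)
    (hm : 22000 * L * A ^ 2 * Q ^ 2 ≤ m) :
    ∃ t : Fin m → X, ∀ a : J → ℂ, ∑ k, ‖a k‖ ≤ A →
      (Fintype.card X : ℝ) ≤ ∑ x, ‖∑ k, a k * e k x‖ ^ 2 →
      ∃ i, 1 / 4 ≤ ‖∑ k, a k * e k (t i)‖ := by
  classical
  have hN : (0 : ℝ) < Fintype.card X := by exact_mod_cast Fintype.card_pos
  have hL' : (0 : ℝ) < L := by exact_mod_cast hL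
  have hm0 : 0 < m := by
    have : (0 : ℝ) < m := lt_of_lt_of_le (by positivity) hm
    exact_mod_cast this
  set u : ℕ → ℝ := fun l => (2 : ℝ) ^ l / 2 with hu
  have hu0 : ∀ l, 0 < u l := fun l => by simp only [hu]; positivity
  set s : ℕ → ℕ := fun l => ⌈4096 * Q * A ^ 2 / u l ^ 2⌉₊ with hs
  set β : ℕ → ℝ := fun l => 3 / (16 * L * u l ^ 2) with hβ
  let c : ℕ → ℝ := fun l => if u l ≤ A then Real.exp (-(β l * m)) else 0
  let h : (l : ℕ) → (Fin (s l) → Option (J × Fin 4)) → X → ℂ := fun l v x =>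
    ((2 * A / s l : ℝ) : ℂ) * ∑ j, atom e (v j) x
  let S : (l : ℕ) → (Fin (s l) → Option (J × Fin 4)) → Finset X := fun l v =>
    Finset.univ.filter fun x => 3 / 4 * u l ≤ ‖h l v x‖
  let G : (Σ l : Fin L, (Fin (s l) → Option (J × Fin 4))) → Finset X := fun i =>
    if u i.1 ≤ A ∧ β i.1 * Fintype.card X ≤ (S i.1 i.2).card then S i.1 i.2 else Finset.univ
  have hGcard : ∀ i, ((G i)ᶜ.card : ℝ) ^ m ≤
      (Fintype.card X : ℝ) ^ m * c i.1 := by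
    intro i
    by_cases hi : u i.1 ≤ A ∧ β i.1 * Fintype.card X ≤ (S i.1 i.2).card
    · simp only [G, c, if_pos hi, if_pos hi.1]
      rw [Finset.card_compl, Nat.cast_sub (Finset.card_le_univ _)]
      have h1 : (Fintype.card X : ℝ) - (S i.1 i.2).card ≤
          Fintype.card X * Real.exp (-β i.1) := by
        nlinarith [Real.add_one_le_exp (-β i.1), hi.2]
      have h2 : (0 : ℝ) ≤ (Fintype.card X : ℝ) - (S i.1 i.2).card := by
        rw [sub_nonneg]; exact_mod_cast Finset.card_le_univ _
      calc _ ≤ (Fintype.card X * Real.exp (-β i.1)) ^ m := pow_le_pow_left₀ h2 h1 m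
        _ = _ := by
          rw [mul_pow, ← Real.exp_nat_mul]
          congr 2
          ring
    · simp only [G, if_neg hi, Finset.compl_univ, Finset.card_empty, Nat.cast_zero,
        zero_pow hm0.ne', c]
      positivity
  have hlevel : ∀ l : Fin L, (Fintype.card (Option (J × Fin 4)) : ℝ) ^ s l *
      c l < 1 / L := by
    intro l
    simp only [c]
    split_ifs with hl
    · have hcard : (Fintype.card (Option (J × Fin 4)) : ℝ) ≤ Real.exp Q := by
        rw [← Real.log_le_iff_le_exp (by positivity)]
        refine le_trans (le_of_eq ?_) hQJ
        simp [mul_comm]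
      have hs1 : (s l : ℝ) ≤ 4097 * Q * A ^ 2 / u l ^ 2 := by
        have h1 : (s l : ℝ) ≤ 4096 * Q * A ^ 2 / u l ^ 2 + 1 :=
          (Nat.ceil_lt_add_one (by positivity)).le
        have h2 : 1 ≤ Q * A ^ 2 / u l ^ 2 := by
          rw [le_div_iff₀ (pow_pos (hu0 l) 2)]
          nlinarith [hu0 l, pow_le_pow_left₀ (hu0 l).le hl 2, sq_nonneg A]
        calc (s l : ℝ) ≤ 4096 * Q * A ^ 2 / u l ^ 2 + Q * A ^ 2 / u l ^ 2 := by linarith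
          _ = _ := by ring
      have hone : 1 ≤ Q * A ^ 2 / u l ^ 2 := by
        rw [le_div_iff₀ (pow_pos (hu0 l) 2)]
        nlinarith [hu0 l, pow_le_pow_left₀ (hu0 l).le hl 2, sq_nonneg A]
      have hlogL : (L : ℝ) ≤ Real.exp Q := (Real.log_le_iff_le_exp hL').1 hQL
      have hexp : Q * s l + Q < β l * m := by
        have h1 : Q * s l + Q ≤ Q * (4098 * Q * A ^ 2 / u l ^ 2) := by
          have : (s l : ℝ) + 1 ≤ 4098 * Q * A ^ 2 / u l ^ 2 := by
            calc (s l : ℝ) + 1 ≤ 4097 * Q * A ^ 2 / u l ^ 2 + Q * A ^ 2 / u l ^ 2 :=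
                  add_le_add hs1 hone
              _ = _ := by ring
          nlinarith
        have h2 : β l * (22000 * L * A ^ 2 * Q ^ 2) ≤ β l * m :=
          mul_le_mul_of_nonneg_left hm (by simp only [hβ]; positivity)
        have h3 : β l * (22000 * L * A ^ 2 * Q ^ 2) = 4125 * (Q ^ 2 * A ^ 2 / u l ^ 2) := by
          have := (hu0 l).ne'
          simp only [hβ]; field_simp; ring
        have h4 : Q * (4098 * Q * A ^ 2 / u l ^ 2) = 4098 * (Q ^ 2 * A ^ 2 / u l ^ 2) := by ring
        have h5 : 0 < Q ^ 2 * A ^ 2 / u l ^ 2 := by have := hu0 l; positivity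
        linarith
      calc (Fintype.card (Option (J × Fin 4)) : ℝ) ^ s l * Real.exp (-(β l * m))
          ≤ Real.exp Q ^ s l * Real.exp (-(β l * m)) := by gcongr
        _ = Real.exp (Q * s l - β l * m) := by
            rw [← Real.exp_nat_mul, ← Real.exp_add]; congr 1; ring
        _ < Real.exp (-Q) := Real.exp_lt_exp.2 (by linarith)
        _ ≤ 1 / L := by
            rw [Real.exp_neg, ← one_div]
            exact one_div_le_one_div_of_le hL' hlogL
    · rw [mul_zero]; positivity
  obtain ⟨t, ht⟩ := exists_forall_exists_mem G m (by
    calc ∑ i, ((G i)ᶜ.card : ℝ) ^ m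
        ≤ ∑ i : (Σ l : Fin L, (Fin (s l) → Option (J × Fin 4))), (Fintype.card X : ℝ) ^ m *
          c i.1 :=
          Finset.sum_le_sum fun i _ => hGcard i
      _ = (Fintype.card X : ℝ) ^ m * ∑ l : Fin L,
          (Fintype.card (Option (J × Fin 4)) : ℝ) ^ s l *
            c l := by
          rw [← Finset.mul_sum, Fintype.sum_sigma]
          congr 1
          refine Finset.sum_congr rfl fun l _ => ?_
          dsimp only
          rw [Finset.sum_const, Finset.card_univ, Fintype.card_fun, Fintype.card_fin,
            nsmul_eq_mul]
          push_cast
          rfl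
      _ < (Fintype.card X : ℝ) ^ m * ∑ l : Fin L, (1 / L : ℝ) := by
          refine mul_lt_mul_of_pos_left ?_ (by positivity)
          exact Finset.sum_lt_sum_of_nonempty ⟨⟨0, hL⟩, Finset.mem_univ _⟩ fun l _ => hlevel l
      _ = (Fintype.card X : ℝ) ^ m := by
          rw [Finset.sum_const, Finset.card_univ, Fintype.card_fin, nsmul_eq_mul]
          field_simp)
  refine ⟨t, fun a ha hsum => ?_⟩
  set f : X → ℂ := fun x => ∑ k, a k * e k x with hf
  have hfA : ∀ x, ‖f x‖ ≤ A := by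
    intro x
    refine (norm_sum_le _ _).trans (le_trans (Finset.sum_le_sum fun k _ => ?_) ha)
    rw [norm_mul]
    exact mul_le_of_le_one_right (norm_nonneg _) (he k x)
  obtain ⟨l, hl, hlc⟩ := exists_large_level (fun x => ‖f x‖) (fun x => norm_nonneg _) hL
    (fun x => (hfA x).trans_lt hAL) hsum
  have hβl : 0 < β l := by have := hu0 l; simp only [hβ]; positivity
  have hulA : u l ≤ A := by
    have hpos : 0 < (Finset.univ.filter fun x => (2 : ℝ) ^ l / 2 ≤ ‖f x‖).card := by
      have : (0 : ℝ) < (Finset.univ.filter fun x => (2 : ℝ) ^ l / 2 ≤ ‖f x‖).card :=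
        lt_of_lt_of_le (mul_pos hβl hN) hlc
      exact_mod_cast this
    obtain ⟨x, hx⟩ := Finset.card_pos.1 hpos
    exact (Finset.mem_filter.1 hx).2.trans (hfA x)
  have hsl : 4096 * Q * A ^ 2 / u l ^ 2 ≤ s l := Nat.le_ceil _
  have hs0 : 0 < s l := Nat.ceil_pos.2 (by have := hu0 l; positivity)
  obtain ⟨v, hv⟩ := exists_atom_average he hA ha (τ := u l / (16 * A))
    (by have := hu0 l; positivity) (by rw [div_le_iff₀ (by positivity)]; linarith) hs0 (by
      calc 16 * Real.log (4 * Fintype.card X) ≤ 16 * Q := by linarith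
        _ = 4096 * Q * A ^ 2 / u l ^ 2 * (u l / (16 * A)) ^ 2 := by
            have := (hu0 l).ne'
            field_simp; norm_num
        _ ≤ _ := by gcongr)
  have hτ : 4 * A * (u l / (16 * A)) = u l / 4 := by field_simp; ring
  rw [hτ] at hv
  have hcond : u l ≤ A ∧ β l * Fintype.card X ≤ (S l v).card := by
    refine ⟨hulA, hlc.trans ?_⟩
    have : (Finset.univ.filter fun x => (2 : ℝ) ^ l / 2 ≤ ‖f x‖) ⊆ S l v := by
      intro x hx
      have h1 : u l ≤ ‖f x‖ := (Finset.mem_filter.1 hx).2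
      refine Finset.mem_filter.2 ⟨Finset.mem_univ _, ?_⟩
      have h2 : ‖f x - h l v x‖ ≤ u l / 4 := hv x
      have h3 := norm_sub_norm_le (f x) (h l v x)
      linarith
    exact_mod_cast Finset.card_le_card this
  obtain ⟨i, hi⟩ := ht ⟨⟨l, hl⟩, v⟩
  simp only [G, if_pos hcond] at hi
  have h1 : 3 / 4 * u l ≤ ‖h l v (t i)‖ := (Finset.mem_filter.1 hi).2
  have h2 : ‖f (t i) - h l v (t i)‖ ≤ u l / 4 := hv (t i)
  have h3 := norm_sub_norm_le (h l v (t i)) (f (t i))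
  rw [norm_sub_rev] at h3
  have h4 : 1 / 2 ≤ u l := by
    simp only [hu]
    have : (1 : ℝ) ≤ 2 ^ l := one_le_pow₀ (by norm_num)
    linarith
  exact ⟨i, by linarith⟩

theorem norm_expk (d : ℕ) (k : Fin d → ℤ) (x : Fin d → ℝ) : ‖expk d k x‖ = 1 := by
  rw [expk, Complex.norm_exp_ofReal_mul_I]

theorem expk_eq_prod (d : ℕ) (k : Fin d → ℤ) (x : Fin d → ℝ) :
    expk d k x = ∏ i, Complex.exp ((2 * Real.pi * (k i * x i) : ℝ) * Complex.I) := by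
  rw [expk, ← Complex.exp_sum]
  congr 1
  push_cast
  rw [Finset.mul_sum, Finset.sum_mul]

theorem conj_expk_mul_expk (d : ℕ) (k l : Fin d → ℤ) (x : Fin d → ℝ) :
    (starRingEnd ℂ) (expk d l x) * expk d k x = expk d (k - l) x := by
  rw [expk, expk, expk, ← Complex.exp_conj, ← Complex.exp_add]
  congr 1
  simp only [map_mul, Complex.conj_ofReal, Complex.conj_I, Pi.sub_apply, Int.cast_sub, sub_mul,
    Finset.sum_sub_distrib]
  push_cast
  ring

/-- The equispaced grid with `P` points in each direction. -/
def gridPoint (d P : ℕ) (g : Fin d → Fin P) : Fin d → ℝ := fun i => (g i : ℝ) / P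

theorem gridPoint_mem_cube (d P : ℕ) (g : Fin d → Fin P) : gridPoint d P g ∈ cube d := by
  intro i _
  have hP : (0 : ℝ) < P := by exact_mod_cast (Nat.zero_le _).trans_lt (g i).2
  refine ⟨by simp only [gridPoint]; positivity, ?_⟩
  rw [gridPoint, div_lt_one hP]
  exact_mod_cast (g i).2

theorem sum_exp_grid {P : ℕ} (j : ℤ) (hj : ¬ (P : ℤ) ∣ j) :
    ∑ g : Fin P, Complex.exp ((2 * Real.pi * (j * ((g : ℝ) / P)) : ℝ) * Complex.I) = 0 := by
  rcases Nat.eq_zero_or_pos P with rfl | hP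
  · simp
  have hPc : (P : ℂ) ≠ 0 := by exact_mod_cast hP.ne'
  set z : ℂ := Complex.exp (2 * Real.pi * Complex.I * (j / P)) with hz
  have h1 : ∀ g : Fin P, Complex.exp ((2 * Real.pi * (j * ((g : ℝ) / P)) : ℝ) * Complex.I) =
      z ^ (g : ℕ) := by
    intro g
    rw [hz, ← Complex.exp_nat_mul]
    congr 1
    push_cast
    ring
  have hzP : z ^ P = 1 := by
    rw [hz, ← Complex.exp_nat_mul, Complex.exp_eq_one_iff]
    exact ⟨j, by field_simp⟩
  have hz1 : z ≠ 1 := by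
    rw [hz, Ne, Complex.exp_eq_one_iff]
    rintro ⟨n, hn⟩
    apply hj
    have h2 : (2 * Real.pi * Complex.I : ℂ) ≠ 0 := Complex.two_pi_I_ne_zero
    have h3 : (j : ℂ) / P = n := by
      apply mul_left_cancel₀ h2
      rw [hn]; ring
    rw [div_eq_iff hPc] at h3
    refine ⟨n, ?_⟩
    rw [mul_comm]
    exact_mod_cast h3
  rw [Finset.sum_congr rfl fun g _ => h1 g, Fin.sum_univ_eq_sum_range (fun g => z ^ g) P,
    geom_sum_eq hz1, hzP, sub_self, zero_div]

theorem sum_expk_grid {d P : ℕ} (k : Fin d → ℤ) (h : ∀ i, |k i| < P) :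
    ∑ g : Fin d → Fin P, expk d k (gridPoint d P g) = if k = 0 then (P : ℂ) ^ d else 0 := by
  simp_rw [expk_eq_prod, gridPoint]
  rw [← Fintype.prod_sum fun (i : Fin d) (g : Fin P) =>
    Complex.exp ((2 * Real.pi * (k i * ((g : ℝ) / P)) : ℝ) * Complex.I)]
  split_ifs with hk
  · subst hk
    simp
  · obtain ⟨i, hi⟩ := Function.ne_iff.1 hk
    refine Finset.prod_eq_zero (Finset.mem_univ i) (sum_exp_grid _ fun hdvd => hi ?_)
    exact Int.eq_zero_of_abs_lt_dvd hdvd (h i)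

/-- Discrete Parseval identity on the grid. -/
theorem sum_normSq_grid {d M : ℕ} (Λ : Finset (Fin d → ℤ)) (hΛ : ∀ k ∈ Λ, ∀ i, |k i| ≤ (M : ℤ))
    (a : (Fin d → ℤ) → ℂ) :
    ∑ g : Fin d → Fin (2 * M + 1), ‖∑ k ∈ Λ, a k * expk d k (gridPoint d (2 * M + 1) g)‖ ^ 2 =
      (2 * M + 1 : ℝ) ^ d * ∑ k ∈ Λ, ‖a k‖ ^ 2 := by
  have h : ((∑ g : Fin d → Fin (2 * M + 1),
      ‖∑ k ∈ Λ, a k * expk d k (gridPoint d (2 * M + 1) g)‖ ^ 2 : ℝ) : ℂ) =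
      (((2 * M + 1 : ℝ) ^ d * ∑ k ∈ Λ, ‖a k‖ ^ 2 : ℝ) : ℂ) := by
    push_cast
    simp_rw [← Complex.conj_mul', map_sum, map_mul, Finset.sum_mul_sum]
    rw [Finset.sum_comm, Finset.mul_sum]
    refine Finset.sum_congr rfl fun l hl => ?_
    rw [Finset.sum_comm]
    have : ∀ k ∈ Λ, ∑ g : Fin d → Fin (2 * M + 1),
        (starRingEnd ℂ) (a l) * (starRingEnd ℂ) (expk d l (gridPoint d (2 * M + 1) g)) *
          (a k * expk d k (gridPoint d (2 * M + 1) g)) =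
        if l = k then (starRingEnd ℂ) (a l) * a k * (2 * M + 1) ^ d else 0 := by
      intro k hk
      have h1 : ∀ g : Fin d → Fin (2 * M + 1),
          (starRingEnd ℂ) (a l) * (starRingEnd ℂ) (expk d l (gridPoint d (2 * M + 1) g)) *
          (a k * expk d k (gridPoint d (2 * M + 1) g)) =
          (starRingEnd ℂ) (a l) * a k * expk d (k - l) (gridPoint d (2 * M + 1) g) := by
        intro g
        rw [← conj_expk_mul_expk]; ring
      rw [Finset.sum_congr rfl fun g _ => h1 g, ← Finset.mul_sum, sum_expk_grid]
      · simp only [sub_eq_zero, eq_comm (a := k)]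
        split_ifs <;> simp
      · intro i
        have h2 := abs_sub (k i) (l i)
        have h3 := hΛ k hk i
        have h4 := hΛ l hl i
        simp only [Pi.sub_apply]
        push_cast
        linarith
    rw [Finset.sum_congr rfl this, Finset.sum_ite_eq, if_pos hl]
    ring
  exact_mod_cast h

section Fourier

/-- The normalized Haar measure on the circle, as used by Mathlib for multivariate Fourier
series. -/
local instance circleHaar : MeasureSpace UnitAddCircle := ⟨AddCircle.haarAddCircle⟩

theorem circleHaar_isProbabilityMeasure :
    IsProbabilityMeasure (volume : Measure UnitAddCircle) :=
  inferInstanceAs (IsProbabilityMeasure AddCircle.haarAddCircle)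

attribute [local instance] circleHaar_isProbabilityMeasure

/-- The cube `(0,1]^d`. -/
def cubeIoc (d : ℕ) : Set (Fin d → ℝ) :=
  {x | ∀ i, x i ∈ Set.Ioc ((0 : Fin d → ℝ) i) ((0 : Fin d → ℝ) i + 1)}

theorem cubeIoc_ae_eq_cube (d : ℕ) : cubeIoc d =ᵐ[volume] cube d := by
  have h1 : cubeIoc d = Set.univ.pi fun _ => Set.Ioc (0 : ℝ) 1 := by
    ext x; simp [cubeIoc]
  rw [h1, cube]
  exact (Measure.univ_pi_Ioc_ae_eq_Icc (f := fun _ => (0 : ℝ)) (g := fun _ => 1)).trans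
    (Measure.univ_pi_Ico_ae_eq_Icc (f := fun _ => (0 : ℝ)) (g := fun _ => 1)).symm

theorem cube_subset_Icc (d : ℕ) : cube d ⊆ Set.Icc 0 1 :=
  fun _ hx => ⟨fun i => (hx i trivial).1, fun i => (hx i trivial).2.le⟩

theorem measurableSet_cube (d : ℕ) : MeasurableSet (cube d) :=
  MeasurableSet.univ_pi fun _ => measurableSet_Ico

/-- The function on the torus that agrees with `f` on `(0,1]^d`. -/
def toTorus (d : ℕ) (f : (Fin d → ℝ) → ℂ) : UnitAddTorus (Fin d) → ℂ :=
  fun y => f (UnitAddTorus.measurableEquivPiIoc (0 : Fin d → ℝ) y).1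

theorem toTorus_coe (d : ℕ) (f : (Fin d → ℝ) → ℂ) {x : Fin d → ℝ} (hx : x ∈ cubeIoc d) :
    toTorus d f (fun i => (x i : UnitAddCircle)) = f x := by
  have h := (UnitAddTorus.measurableEquivPiIoc (0 : Fin d → ℝ)).apply_symm_apply ⟨x, hx⟩
  rw [UnitAddTorus.coe_symm_measurableEquivPiIoc_apply] at h
  rw [toTorus, h]

theorem mFourier_coe (d : ℕ) (k : Fin d → ℤ) (x : Fin d → ℝ) :
    UnitAddTorus.mFourier k (fun i => (x i : UnitAddCircle)) = expk d k x := by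
  rw [expk, UnitAddTorus.mFourier, ContinuousMap.coe_mk]
  simp_rw [fourier_coe_apply]
  rw [← Complex.exp_sum]
  congr 1
  push_cast
  rw [Finset.mul_sum, Finset.sum_mul]
  exact Finset.sum_congr rfl fun i _ => by ring

theorem mFourierCoeff_toTorus (d : ℕ) (f : (Fin d → ℝ) → ℂ) (k : Fin d → ℤ) :
    UnitAddTorus.mFourierCoeff (toTorus d f) k = fCoeff d f k := by
  rw [UnitAddTorus.mFourierCoeff_eq_integral _ _ 0, fCoeff,
    ← setIntegral_congr_set (cubeIoc_ae_eq_cube d)]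
  refine setIntegral_congr_fun ?_ fun x hx => ?_
  · exact MeasurableSet.univ_pi' fun i => measurableSet_Ioc
  · rw [toTorus_coe d f hx, mFourier_coe, smul_eq_mul, mul_comm]

theorem memLp_toTorus (d : ℕ) {f : (Fin d → ℝ) → ℂ} (hf : Continuous f) :
    MemLp (toTorus d f) 2 (volume : Measure (UnitAddTorus (Fin d))) := by
  obtain ⟨C, hC⟩ := (isCompact_Icc (a := (0 : Fin d → ℝ)) (b := 1)).exists_bound_of_continuousOn
    hf.continuousOn
  refine MemLp.of_bound ?_ C (Filter.Eventually.of_forall fun y => hC _ ?_)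
  · exact (hf.measurable.comp (measurable_subtype_coe.comp
      (UnitAddTorus.measurableEquivPiIoc (0 : Fin d → ℝ)).measurable)).aestronglyMeasurable
  · have := (UnitAddTorus.measurableEquivPiIoc (0 : Fin d → ℝ) y).2
    exact ⟨fun i => (this i).1.le, fun i => by simpa using (this i).2⟩

/-- Parseval's identity. -/
theorem hasSum_sq_fCoeff (d : ℕ) {f : (Fin d → ℝ) → ℂ} (hf : Continuous f) :
    HasSum (fun k => ‖fCoeff d f k‖ ^ 2) (∫ x in cube d, ‖f x‖ ^ 2) := by
  have hL := memLp_toTorus d hf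
  have h := UnitAddTorus.hasSum_sq_mFourierCoeff hL.toLp
  have h1 : ∀ k, UnitAddTorus.mFourierCoeff (hL.toLp : UnitAddTorus (Fin d) → ℂ) k =
      fCoeff d f k := by
    intro k
    rw [← mFourierCoeff_toTorus]
    refine integral_congr_ae ?_
    filter_upwards [hL.coeFn_toLp] with y hy
    rw [hy]
  have h2 : ∫ y, ‖(hL.toLp : UnitAddTorus (Fin d) → ℂ) y‖ ^ 2 = ∫ x in cube d, ‖f x‖ ^ 2 := by
    have h3 : ∫ y, ‖(hL.toLp : UnitAddTorus (Fin d) → ℂ) y‖ ^ 2 =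
        ∫ y, ‖toTorus d f y‖ ^ 2 := by
      refine integral_congr_ae ?_
      filter_upwards [hL.coeFn_toLp] with y hy
      rw [hy]
    rw [h3, UnitAddTorus.integral_preimage _ 0, ← setIntegral_congr_set (cubeIoc_ae_eq_cube d)]
    refine setIntegral_congr_fun ?_ fun x hx => ?_
    · exact MeasurableSet.univ_pi' fun i => measurableSet_Ioc
    · rw [toTorus_coe d f hx]
  rw [← h2]
  simpa only [h1] using h

/-- Fourier inversion on the cube for continuous functions with absolutely summable Fourier
coefficients. -/
theorem hasSum_fCoeff (d : ℕ) {f : (Fin d → ℝ) → ℂ} (hf : Continuous f)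
    (hs : Summable fun k => ‖fCoeff d f k‖) {x : Fin d → ℝ} (hx : x ∈ cube d) :
    HasSum (fun k => fCoeff d f k * expk d k x) (f x) := by
  have hL := memLp_toTorus d hf
  have h := UnitAddTorus.hasSum_mFourier_series_L2 hL.toLp
  have h1 : ∀ k, UnitAddTorus.mFourierCoeff (hL.toLp : UnitAddTorus (Fin d) → ℂ) k =
      fCoeff d f k := by
    intro k
    rw [← mFourierCoeff_toTorus]
    refine integral_congr_ae ?_
    filter_upwards [hL.coeFn_toLp] with y hy
    rw [hy]
  simp only [h1] at h
  have hsC : Summable fun k => fCoeff d f k • (UnitAddTorus.mFourier k) := by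
    refine Summable.of_norm ?_
    simpa only [norm_smul, UnitAddTorus.mFourier_norm, mul_one] using hs
  set G : C(UnitAddTorus (Fin d), ℂ) := ∑' k, fCoeff d f k • (UnitAddTorus.mFourier k) with hG
  have hGs : HasSum (fun k => fCoeff d f k • (UnitAddTorus.mFourier k)) G := hsC.hasSum
  have h2 : HasSum (fun k => fCoeff d f k • UnitAddTorus.mFourierLp (d := Fin d) 2 k)
      (ContinuousMap.toLp (E := ℂ) 2 volume ℂ G) := by
    simpa [map_smul] using! (ContinuousMap.toLp (E := ℂ) 2
      (volume : Measure (UnitAddTorus (Fin d))) ℂ).hasSum hGs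
  have h3 : toTorus d f =ᵐ[volume] G := by
    have h4 := h.unique h2
    have h5 := hL.coeFn_toLp
    rw [h4] at h5
    exact h5.symm.trans (ContinuousMap.coeFn_toLp volume G)
  let pr : (Fin d → ℝ) → UnitAddTorus (Fin d) := fun x i => (x i : UnitAddCircle)
  have hpr : Continuous pr :=
    continuous_pi fun i => (AddCircle.continuous_mk' 1).comp (continuous_apply i)
  have h4 : f =ᵐ[volume.restrict (cube d)] fun x => G (pr x) := by
    rw [← Measure.restrict_congr_set (cubeIoc_ae_eq_cube d)]
    have h5 : ∫⁻ y, ‖toTorus d f y - G y‖ₑ = 0 := by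
      rw [lintegral_eq_zero_iff']
      · filter_upwards [h3] with y hy
        simp [hy]
      · exact (hL.1.sub G.continuous.aestronglyMeasurable).enorm
    rw [UnitAddTorus.lintegral_preimage _ 0,
      setLIntegral_congr_fun (g := fun x => ‖f x - G (pr x)‖ₑ)
      (MeasurableSet.univ_pi' fun i => measurableSet_Ioc)
      (fun x hx => by beta_reduce; rw [toTorus_coe d f hx]), lintegral_eq_zero_iff'] at h5
    · filter_upwards [h5] with x hx
      simpa [sub_eq_zero] using hx
    · exact (hf.sub (G.continuous.comp hpr)).aestronglyMeasurable.enorm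
  have h5 : Set.EqOn f (fun x => G (pr x)) (cube d) := by
    refine Measure.eqOn_of_ae_eq h4 hf.continuousOn (G.continuous.comp hpr).continuousOn ?_
    rw [cube, interior_pi_set Set.finite_univ, closure_pi_set]
    refine Set.pi_mono fun i _ => ?_
    rw [interior_Ico, closure_Ioo zero_ne_one]
    exact Set.Ico_subset_Icc_self
  rw [h5 hx]
  have h6 := (ContinuousMap.evalCLM ℂ (pr x)).hasSum hGs
  simpa only [map_smul, ContinuousMap.evalCLM_apply, smul_eq_mul, pr, mFourier_coe,
    Function.comp_def] using! h6

end Fourier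

section Counting

theorem one_le_wt (d : ℕ) (k : Fin d → ℤ) : 1 ≤ wt d k :=
  Finset.prod_induction _ (fun x : ℝ => 1 ≤ x)
    (fun _ _ ha hb => one_le_mul_of_one_le_of_one_le ha hb) le_rfl fun i _ => by simp

theorem one_add_abs_le_wt {d : ℕ} (k : Fin d → ℤ) (i : Fin d) : 1 + |(k i : ℝ)| ≤ wt d k := by
  rw [wt, ← Finset.mul_prod_erase _ _ (Finset.mem_univ i)]
  refine le_mul_of_one_le_right (by positivity) ?_
  exact Finset.prod_induction _ (fun x : ℝ => 1 ≤ x)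
    (fun _ _ ha hb => one_le_mul_of_one_le_of_one_le ha hb) le_rfl fun i _ => by simp

theorem wt_succ {d : ℕ} (k : Fin (d + 1) → ℤ) :
    wt (d + 1) k = (1 + |(k 0 : ℝ)|) * wt d (Fin.tail k) := by
  rw [wt, Fin.prod_univ_succ]; rfl

theorem card_filter_natAbs_le (J : Finset ℤ) (i : ℕ) :
    (J.filter fun j => j.natAbs = i).card ≤ 2 := by
  have : (J.filter fun j => j.natAbs = i) ⊆ {(i : ℤ), -(i : ℤ)} := by
    intro j hj
    simp only [Finset.mem_filter] at hj
    simp only [Finset.mem_insert, Finset.mem_singleton]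
    omega
  exact (Finset.card_le_card this).trans Finset.card_le_two

theorem natAbs_mem_range_floor {j : ℤ} {T : ℝ} (hj : 1 + |(j : ℝ)| ≤ T) :
    j.natAbs ∈ Finset.range ⌊T⌋₊ := by
  rw [Finset.mem_range, ← Nat.succ_le_iff, Nat.le_floor_iff' (Nat.succ_ne_zero _)]
  push_cast
  rw [Nat.cast_natAbs, Int.cast_abs]
  linarith

theorem card_int_le {J : Finset ℤ} {T : ℝ} (hT : 1 ≤ T) (hJ : ∀ j ∈ J, 1 + |(j : ℝ)| ≤ T) :
    (J.card : ℝ) ≤ 2 * T := by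
  have h := Finset.card_le_mul_card_image_of_maps_to (f := Int.natAbs) (s := J)
    (t := Finset.range ⌊T⌋₊) (fun j hj => natAbs_mem_range_floor (hJ j hj)) 2
    fun i _ => card_filter_natAbs_le J i
  rw [Finset.card_range] at h
  have h2 : (J.card : ℝ) ≤ 2 * ⌊T⌋₊ := by exact_mod_cast h
  have := Nat.floor_le (zero_le_one.trans hT)
  linarith

theorem sum_inv_int_le {J : Finset ℤ} {T : ℝ} (hT : 1 ≤ T) (hJ : ∀ j ∈ J, 1 + |(j : ℝ)| ≤ T) :
    ∑ j ∈ J, (1 + |(j : ℝ)|)⁻¹ ≤ 2 * (1 + Real.log T) := by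
  rw [← Finset.sum_fiberwise_of_maps_to (g := Int.natAbs) (t := Finset.range ⌊T⌋₊)
    fun j hj => natAbs_mem_range_floor (hJ j hj)]
  have h1 : ∀ i ∈ Finset.range ⌊T⌋₊, ∑ j ∈ J with j.natAbs = i, (1 + |(j : ℝ)|)⁻¹ ≤
      2 * ((i + 1 : ℕ) : ℝ)⁻¹ := by
    intro i _
    have h2 : ∀ j ∈ J.filter fun j => j.natAbs = i, (1 + |(j : ℝ)|)⁻¹ ≤ ((i + 1 : ℕ) : ℝ)⁻¹ := by
      intro j hj
      rw [← (Finset.mem_filter.1 hj).2]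
      push_cast
      rw [Nat.cast_natAbs, Int.cast_abs, add_comm]
    refine (Finset.sum_le_card_nsmul _ _ _ h2).trans ?_
    rw [nsmul_eq_mul]
    gcongr
    exact_mod_cast card_filter_natAbs_le J i
  refine (Finset.sum_le_sum h1).trans ?_
  rw [← Finset.mul_sum]
  have h3 := harmonic_floor_le_one_add_log T hT
  rw [harmonic] at h3
  push_cast at h3 ⊢
  linarith

/-- The number of points in a hyperbolic cross. -/
theorem card_wt_le (d : ℕ) : ∀ {T : ℝ}, 1 ≤ T → ∀ {S : Finset (Fin (d + 1) → ℤ)},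
    (∀ k ∈ S, wt (d + 1) k ≤ T) → (S.card : ℝ) ≤ 2 ^ (d + 1) * T * (1 + Real.log T) ^ d := by
  induction d with
  | zero =>
    intro T hT S hS
    have h := card_int_le (J := S.image fun k => k 0) hT fun j hj => by
      obtain ⟨k, hk, rfl⟩ := Finset.mem_image.1 hj
      exact (one_add_abs_le_wt k 0).trans (hS k hk)
    rw [Finset.card_image_of_injective] at h
    · simpa using h
    · intro k l hkl
      ext i
      rw [Fin.fin_one_eq_zero i]
      exact hkl
  | succ d ih =>
    intro T hT S hS
    have hlog := Real.log_nonneg hT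
    set J := S.image fun k => k 0 with hJ
    have hJT : ∀ j ∈ J, 1 + |(j : ℝ)| ≤ T := fun j hj => by
      obtain ⟨k, hk, rfl⟩ := Finset.mem_image.1 hj
      exact (one_add_abs_le_wt k 0).trans (hS k hk)
    have h1 : ∀ j ∈ J, ((S.filter fun k => k 0 = j).card : ℝ) ≤
        2 ^ (d + 1) * T * (1 + Real.log T) ^ d * (1 + |(j : ℝ)|)⁻¹ := by
      intro j hj
      have hj0 : 0 < 1 + |(j : ℝ)| := by positivity
      have hTj : 1 ≤ T / (1 + |(j : ℝ)|) := (one_le_div hj0).2 (hJT j hj)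
      have h2 := ih hTj (S := (S.filter fun k => k 0 = j).image Fin.tail) fun l hl => by
        obtain ⟨k, hk, rfl⟩ := Finset.mem_image.1 hl
        obtain ⟨hk, hkj⟩ := Finset.mem_filter.1 hk
        rw [le_div_iff₀ hj0, mul_comm, ← hkj, ← wt_succ]
        exact hS k hk
      rw [Finset.card_image_of_injOn] at h2
      · refine h2.trans ?_
        rw [div_eq_mul_inv]
        have h3 : Real.log (T * (1 + |(j : ℝ)|)⁻¹) ≤ Real.log T := by
          refine Real.log_le_log (by positivity) ?_
          exact mul_le_of_le_one_right (by positivity) (inv_le_one_of_one_le₀ (by simp))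
        have h4 : 0 ≤ Real.log (T * (1 + |(j : ℝ)|)⁻¹) :=
          Real.log_nonneg (by rwa [← div_eq_mul_inv])
        calc _ ≤ 2 ^ (d + 1) * (T * (1 + |(j : ℝ)|)⁻¹) * (1 + Real.log T) ^ d := by gcongr
          _ = _ := by ring
      · intro k hk l hl hkl
        simp only [Finset.mem_coe, Finset.mem_filter] at hk hl
        rw [← Fin.cons_self_tail k, ← Fin.cons_self_tail l, hkl, hk.2, hl.2]
    rw [Finset.card_eq_sum_card_image (fun k => k 0) S]
    push_cast
    refine (Finset.sum_le_sum h1).trans ?_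
    rw [← Finset.mul_sum]
    calc _ ≤ 2 ^ (d + 1) * T * (1 + Real.log T) ^ d * (2 * (1 + Real.log T)) := by
          gcongr
          exact sum_inv_int_le hT hJT
      _ = _ := by ring

theorem finite_wt_le (d : ℕ) (T : ℝ) : {k : Fin d → ℤ | wt d k ≤ T}.Finite := by
  refine (Fintype.piFinset fun _ : Fin d => Finset.Icc (-⌈T⌉) ⌈T⌉).finite_toSet.subset
    fun k hk => ?_
  simp only [Finset.mem_coe, Fintype.mem_piFinset, Finset.mem_Icc, ← abs_le]
  intro i
  have h := (one_add_abs_le_wt k i).trans hk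
  have : ((|k i| : ℤ) : ℝ) ≤ ⌈T⌉ := by
    push_cast
    linarith [Int.le_ceil T]
  exact_mod_cast this

end Counting

section Sequences

/-- The sequence `a` is nonnegative and its `ℓ_θ` (quasi-)norm is at most `K`. -/
def SeqBound {ι : Type*} (θ : ℝ≥0∞) (K : ℝ) (a : ι → ℝ) : Prop :=
  (∀ k, 0 ≤ a k) ∧ (θ = ∞ → ∀ k, a k ≤ K) ∧
    (θ ≠ ∞ → ∀ S : Finset ι, ∑ k ∈ S, a k ^ θ.toReal ≤ K ^ θ.toReal)

variable {ι : Type*} {θ : ℝ≥0∞} {K : ℝ} {a : ι → ℝ}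

theorem SeqBound.sum_le (h : SeqBound θ K a) (hK : 0 ≤ K) (hθ : 1 ≤ θ) (S : Finset ι) :
    ∑ k ∈ S, a k ≤ K * (S.card : ℝ) ^ (1 - 1 / θ.toReal) := by
  obtain ⟨h0, h1, h2⟩ := h
  by_cases hθt : θ = ∞
  · have := Finset.sum_le_card_nsmul S a K fun k _ => h1 hθt k
    simpa [hθt, mul_comm] using this
  · have ht : 1 ≤ θ.toReal := by
      simpa using ENNReal.toReal_mono hθt hθ
    have ht0 : 0 < θ.toReal := by linarith
    have h3 := Real.rpow_sum_le_const_mul_sum_rpow S a ht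
    simp only [abs_of_nonneg (h0 _)] at h3
    have h4 : (∑ k ∈ S, a k) ^ θ.toReal ≤ (S.card : ℝ) ^ (θ.toReal - 1) * K ^ θ.toReal :=
      h3.trans (by gcongr; exact h2 hθt S)
    have h5 := (Real.le_rpow_inv_iff_of_pos (Finset.sum_nonneg fun k _ => h0 k) (by positivity)
      ht0).2 h4
    refine h5.trans_eq ?_
    rw [Real.mul_rpow (by positivity) (by positivity), ← Real.rpow_mul (by positivity),
      Real.rpow_rpow_inv hK ht0.ne', mul_comm]
    congr 2
    field_simp

/-- Stechkin's inequality. -/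
theorem SeqBound.exists_sparse (h : SeqBound θ K a) (hK : 0 < K) (hθ0 : 0 < θ) (hθ : θ ≤ 1)
    {n : ℝ} (hn : 0 < n) :
    ∃ Λ : Finset ι, (Λ.card : ℝ) ≤ n ∧
      ∀ S : Finset ι, Disjoint S Λ → ∑ k ∈ S, a k ≤ K * n ^ (1 - 1 / θ.toReal) := by
  obtain ⟨h0, -, h2⟩ := h
  have hθt : θ ≠ ∞ := (hθ.trans_lt ENNReal.one_lt_top).ne
  specialize h2 hθt
  have ht0 : 0 < θ.toReal := ENNReal.toReal_pos hθ0.ne' hθt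
  have ht1 : θ.toReal ≤ 1 := by simpa using ENNReal.toReal_mono ENNReal.one_ne_top hθ
  set t := θ.toReal
  have hlam : 0 < K * n ^ (-(1 / t)) := by positivity
  have hlamt : (K * n ^ (-(1 / t))) ^ t = K ^ t * n⁻¹ := by
    rw [Real.mul_rpow hK.le (by positivity), ← Real.rpow_mul hn.le, ← Real.rpow_neg_one]
    congr 2
    field_simp
  have hcard : ∀ S : Finset ι, (∀ k ∈ S, K * n ^ (-(1 / t)) ≤ a k) → (S.card : ℝ) ≤ n := by
    intro S hS
    have h3 : S.card • (K ^ t * n⁻¹) ≤ ∑ k ∈ S, a k ^ t := by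
      refine Finset.card_nsmul_le_sum _ _ _ fun k hk => ?_
      rw [← hlamt]
      exact Real.rpow_le_rpow hlam.le (hS k hk) ht0.le
    have h4 := h3.trans (h2 S)
    rw [nsmul_eq_mul] at h4
    have h5 : 0 < K ^ t := by positivity
    have h6 : (S.card : ℝ) * n⁻¹ ≤ 1 := by
      by_contra! h7
      nlinarith
    rwa [← div_eq_mul_inv, div_le_one hn] at h6
  have hfin : {k | K * n ^ (-(1 / t)) ≤ a k}.Finite := by
    by_contra hinf
    obtain ⟨S, hS, hSc⟩ := Set.Infinite.exists_subset_card_eq hinf (⌊n⌋₊ + 1)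
    have h3 := hcard S fun k hk => hS hk
    rw [hSc] at h3
    push_cast at h3
    linarith [Nat.lt_floor_add_one n]
  refine ⟨hfin.toFinset, hcard _ fun k hk => by simpa using hk, fun S hS => ?_⟩
  have h3 : ∀ k ∈ S, a k ≤ a k ^ t * (K * n ^ (-(1 / t))) ^ (1 - t) := by
    intro k hk
    have h4 : a k < K * n ^ (-(1 / t)) := by
      have := Finset.disjoint_left.1 hS hk
      simpa using this
    rcases (h0 k).eq_or_lt with h5 | h5
    · rw [← h5, Real.zero_rpow ht0.ne', zero_mul]
    · calc a k = a k ^ t * a k ^ (1 - t) := by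
            rw [← Real.rpow_add h5]; simp
        _ ≤ _ := by gcongr
  refine (Finset.sum_le_sum h3).trans ?_
  rw [← Finset.sum_mul]
  calc _ ≤ K ^ t * (K * n ^ (-(1 / t))) ^ (1 - t) := by
        gcongr
        exact h2 S
    _ = _ := by
        rw [Real.mul_rpow hK.le (by positivity), ← mul_assoc, ← Real.rpow_add hK,
          ← Real.rpow_mul hn.le, add_sub_cancel, Real.rpow_one]
        congr 2
        field_simp
        ring

theorem sum_wt_inv_le {d : ℕ} {r T : ℝ} (hr : 0 ≤ r) (hT : 0 < T) {c : (Fin d → ℤ) → ℝ}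
    (hc : ∀ k, 0 ≤ wt d k ^ r * c k) {S : Finset (Fin d → ℤ)} (hS : ∀ k ∈ S, T ≤ wt d k) :
    ∑ k ∈ S, c k ≤ T ^ (-r) * ∑ k ∈ S, wt d k ^ r * c k := by
  rw [Finset.mul_sum]
  refine Finset.sum_le_sum fun k hk => ?_
  have hw : 0 < wt d k := zero_lt_one.trans_le (one_le_wt d k)
  have hck : 0 ≤ c k := nonneg_of_mul_nonneg_right (hc k) (by positivity)
  rw [← mul_assoc, Real.rpow_neg hT.le]
  refine le_mul_of_one_le_left hck ?_
  rw [← div_eq_inv_mul, one_le_div (by positivity)]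
  exact Real.rpow_le_rpow hT.le (hS k hk) hr

theorem card_wt_le_of_log_le {d : ℕ} {T y : ℝ} (hT : 0 < T) (hy : Real.log T ≤ y) (hy0 : 0 ≤ y)
    {S : Finset (Fin (d + 1) → ℤ)} (hS : ∀ k ∈ S, wt (d + 1) k ≤ T) :
    (S.card : ℝ) ≤ 2 ^ (d + 1) * T * (1 + y) ^ d := by
  rcases S.eq_empty_or_nonempty with rfl | ⟨k, hk⟩
  · simp only [Finset.card_empty, Nat.cast_zero]; positivity
  · have hT1 : 1 ≤ T := (one_le_wt _ k).trans (hS k hk)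
    have := Real.log_nonneg hT1
    exact (card_wt_le d hT1 hS).trans (by gcongr)

theorem summable_tail_series (d : ℕ) {x : ℝ} (hx0 : 0 < x) (hx1 : x < 1) :
    Summable fun j : ℕ => x ^ j * ((j : ℝ) + 3) ^ d := by
  have h := (summable_nat_add_iff 3).2 (summable_pow_mul_geometric_of_norm_lt_one (R := ℝ) d
    (r := x) (by rwa [Real.norm_of_nonneg hx0.le]))
  have h2 := h.mul_left (x ^ 3)⁻¹
  refine h2.congr fun j => ?_
  push_cast
  rw [pow_add]
  field_simp

/-- The tail of a weighted sequence outside a hyperbolic cross. -/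
theorem exists_tail_bound (d : ℕ) (hθ : 1 < θ) {r : ℝ} (hr : 1 - 1 / θ.toReal < r) :
    ∃ C : ℝ, 0 < C ∧ ∀ K : ℝ, 0 ≤ K → ∀ c : (Fin (d + 1) → ℤ) → ℝ,
      SeqBound θ K (fun k => wt (d + 1) k ^ r * c k) → ∀ T ℓ : ℝ, 0 < T → 1 ≤ ℓ → T ≤ 2 ^ ℓ →
      ∀ S : Finset (Fin (d + 1) → ℤ), (∀ k ∈ S, T < wt (d + 1) k) →
      ∑ k ∈ S, c k ≤ K * (C * (T ^ (-(r + 1 / θ.toReal - 1)) * ℓ ^ (d * (1 - 1 / θ.toReal)))) := by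
  have hs0 : 0 ≤ 1 - 1 / θ.toReal := by
    by_cases hθt : θ = ∞
    · simp [hθt]
    · have h1 : 1 ≤ θ.toReal := by simpa using ENNReal.toReal_mono hθt hθ.le
      rw [sub_nonneg, div_le_one (by linarith)]
      exact h1
  have hs1 : 1 - 1 / θ.toReal ≤ 1 := by
    have : 0 ≤ 1 / θ.toReal := by positivity
    linarith
  have hδ : r + 1 / θ.toReal - 1 = r - (1 - 1 / θ.toReal) := by ring
  have hsum := fun K c S => SeqBound.sum_le (ι := Fin (d + 1) → ℤ) (θ := θ) (K := K) (a := c)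
    (S := S)
  rw [hδ]
  set s := 1 - 1 / θ.toReal
  have hx0 : (0 : ℝ) < 2 ^ (-(r - s)) := by positivity
  have hx1 : (2 : ℝ) ^ (-(r - s)) < 1 :=
    Real.rpow_lt_one_of_one_lt_of_neg one_lt_two (by linarith)
  have hser := summable_tail_series d hx0 hx1
  set x : ℝ := 2 ^ (-(r - s)) with hx
  refine ⟨(2 ^ (d + 2)) ^ s * (∑' j : ℕ, x ^ j * ((j : ℝ) + 3) ^ d), ?_, ?_⟩
  · have := hser.tsum_pos (fun j => by positivity) 0 (by positivity)
    positivity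
  intro K hK c hc T ℓ hT hℓ hTℓ S hS
  have hfib : ∀ k ∈ S, 1 ≤ wt (d + 1) k / T := fun k hk => (one_le_div hT).2 (hS k hk).le
  rw [← Finset.sum_fiberwise_of_maps_to (g := fun k => ⌊Real.logb 2 (wt (d + 1) k / T)⌋₊)
    (t := S.image fun k => ⌊Real.logb 2 (wt (d + 1) k / T)⌋₊)
    fun k hk => Finset.mem_image_of_mem _ hk]
  have hj : ∀ j : ℕ, ∑ k ∈ S with ⌊Real.logb 2 (wt (d + 1) k / T)⌋₊ = j, c k ≤
      K * ((2 ^ (d + 2)) ^ s * (T ^ (-(r - s)) * ℓ ^ (d * s))) * (x ^ j * ((j : ℝ) + 3) ^ d) := by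
    intro j
    set Sj := S.filter fun k => ⌊Real.logb 2 (wt (d + 1) k / T)⌋₊ = j with hSj
    have hlow : ∀ k ∈ Sj, 2 ^ j * T ≤ wt (d + 1) k := by
      intro k hk
      obtain ⟨hk, hkj⟩ := Finset.mem_filter.1 hk
      have h0 := Real.logb_nonneg one_lt_two (hfib k hk)
      have h1 := Nat.floor_le h0
      rw [hkj, Real.le_logb_iff_rpow_le one_lt_two (zero_lt_one.trans_le (hfib k hk)),
        Real.rpow_natCast, le_div_iff₀ hT] at h1
      exact h1
    have hup : ∀ k ∈ Sj, wt (d + 1) k ≤ 2 ^ (j + 1) * T := by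
      intro k hk
      obtain ⟨hk, hkj⟩ := Finset.mem_filter.1 hk
      have h1 := Nat.lt_floor_add_one (Real.logb 2 (wt (d + 1) k / T))
      rw [hkj, Real.logb_lt_iff_lt_rpow one_lt_two (zero_lt_one.trans_le (hfib k hk)),
        div_lt_iff₀ hT] at h1
      exact_mod_cast h1.le
    have hcard : (Sj.card : ℝ) ≤ 2 ^ (d + 2) * (2 ^ j * T) * ((j + 3) * ℓ) ^ d := by
      have hlog : Real.log (2 ^ (j + 1) * T) ≤ (j + 1) + ℓ := by
        rw [Real.log_mul (by positivity) hT.ne', Real.log_pow]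
        have h1 := Real.log_le_log hT hTℓ
        rw [Real.log_rpow two_pos] at h1
        have h2 := Real.log_two_lt_d9
        have h3 := Real.log_two_gt_d9
        push_cast
        nlinarith
      refine (card_wt_le_of_log_le (by positivity) hlog (by positivity) hup).trans ?_
      have : 1 + ((j : ℝ) + 1 + ℓ) ≤ (j + 3) * ℓ := by nlinarith [(Nat.cast_nonneg j : (0 : ℝ) ≤ j)]
      calc _ ≤ 2 ^ (d + 1) * (2 ^ (j + 1) * T) * ((j + 3) * ℓ) ^ d := by gcongr
        _ = _ := by ring
    have hpow : ((j + 3 : ℝ) ^ d) ^ s ≤ (j + 3 : ℝ) ^ d := by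
      refine Real.rpow_le_self_of_one_le (one_le_pow₀ ?_) hs1
      linarith [(Nat.cast_nonneg j : (0 : ℝ) ≤ j)]
    calc ∑ k ∈ Sj, c k ≤ (2 ^ j * T) ^ (-r) * ∑ k ∈ Sj, wt (d + 1) k ^ r * c k :=
          sum_wt_inv_le (by linarith) (by positivity) hc.1 hlow
      _ ≤ (2 ^ j * T) ^ (-r) * (K * (2 ^ (d + 2) * (2 ^ j * T) * ((j + 3) * ℓ) ^ d) ^ s) := by
          gcongr
          refine (hsum K _ Sj hc hK hθ.le).trans ?_
          gcongr
      _ = (2 ^ j * T) ^ (-r) * (2 ^ j * T) ^ s *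
            (K * ((2 ^ (d + 2)) ^ s * (((j + 3 : ℝ) ^ d) ^ s * (ℓ ^ d) ^ s))) := by
          rw [Real.mul_rpow (x := 2 ^ (d + 2) * (2 ^ j * T)) (by positivity) (by positivity),
            Real.mul_rpow (x := 2 ^ (d + 2)) (by positivity) (by positivity), mul_pow _ ℓ,
            Real.mul_rpow (x := ((j : ℝ) + 3) ^ d) (by positivity) (by positivity)]
          ring
      _ ≤ (2 ^ j * T) ^ (-r) * (2 ^ j * T) ^ s *
            (K * ((2 ^ (d + 2)) ^ s * ((j + 3 : ℝ) ^ d * (ℓ ^ d) ^ s))) := by gcongr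
      _ = _ := by
          rw [← Real.rpow_add (by positivity), Real.mul_rpow (by positivity) hT.le,
            ← Real.rpow_natCast ℓ d, ← Real.rpow_mul (by positivity),
            show -r + s = -(r - s) by ring, ← Real.rpow_natCast (2 : ℝ) j,
            ← Real.rpow_mul two_pos.le, mul_comm (j : ℝ), Real.rpow_mul two_pos.le, ← hx,
            Real.rpow_natCast x j]
          ring
  refine (Finset.sum_le_sum fun j _ => hj j).trans ?_
  rw [← Finset.mul_sum]
  have h4 := hser.sum_le_tsum (S.image fun k => ⌊Real.logb 2 (wt (d + 1) k / T)⌋₊)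
    fun j _ => by positivity
  calc _ ≤ K * ((2 ^ (d + 2)) ^ s * (T ^ (-(r - s)) * ℓ ^ (d * s))) *
        (∑' j : ℕ, x ^ j * ((j : ℝ) + 3) ^ d) := by gcongr
    _ = _ := by ring

theorem exists_finset_wt (d : ℕ) {n ℓ : ℝ} (hn : 0 < n) (hℓ : 1 ≤ ℓ) (hnℓ : n ≤ 2 ^ ℓ) :
    ∃ Λ : Finset (Fin (d + 1) → ℤ), (Λ.card : ℝ) ≤ n ∧
      ∀ S, Disjoint S Λ → ∀ k ∈ S, n / (2 ^ (2 * d + 1) * ℓ ^ d) < wt (d + 1) k := by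
  set T := n / (2 ^ (2 * d + 1) * ℓ ^ d) with hT
  have hT0 : 0 < T := by positivity
  have hTn : T ≤ n := by
    refine div_le_self hn.le (one_le_mul_of_one_le_of_one_le ?_ (one_le_pow₀ hℓ))
    exact one_le_pow₀ one_le_two
  refine ⟨(finite_wt_le (d + 1) T).toFinset, ?_, fun S hS k hk => ?_⟩
  · have hlog : Real.log T ≤ ℓ := by
      have h1 := Real.log_le_log hT0 (hTn.trans hnℓ)
      rw [Real.log_rpow two_pos] at h1
      nlinarith [Real.log_two_lt_d9]
    refine (card_wt_le_of_log_le hT0 hlog (by positivity) fun k hk => by simpa using hk).trans ?_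
    calc (2 : ℝ) ^ (d + 1) * T * (1 + ℓ) ^ d ≤ 2 ^ (d + 1) * T * (2 * ℓ) ^ d := by
          gcongr
          linarith
      _ = n := by
          rw [hT, mul_pow]
          field_simp
          ring
  · have := Finset.disjoint_left.1 hS hk
    simpa using this

/-- Sparse approximation of weighted sequences in `ℓ₁`. -/
theorem exists_sparse_bound (d : ℕ) (hθ0 : 0 < θ) {r : ℝ} (hr0 : 0 < r)
    (hr : 1 - 1 / θ.toReal < r) (hK : 0 < K) :
    ∃ C : ℝ, 0 < C ∧ ∀ c : (Fin (d + 1) → ℤ) → ℝ,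
      SeqBound θ K (fun k => wt (d + 1) k ^ r * c k) → ∀ n ℓ : ℝ, 0 < n → 1 ≤ ℓ → n ≤ 2 ^ ℓ →
      ∃ Λ : Finset (Fin (d + 1) → ℤ), (Λ.card : ℝ) ≤ n ∧ ∀ S, Disjoint S Λ →
        ∑ k ∈ S, c k ≤ C * (n ^ (-(r + 1 / θ.toReal - 1)) * ℓ ^ (d * r)) := by
  set D : ℝ := 2 ^ (2 * d + 1) with hD
  have hD0 : 0 < D := by positivity
  rcases lt_or_ge 1 θ with hθ | hθ
  · obtain ⟨C, hC, h⟩ := exists_tail_bound d hθ hr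
    refine ⟨K * (C * D⁻¹ ^ (-(r + 1 / θ.toReal - 1))), by positivity, fun c hc n ℓ hn hℓ hnℓ => ?_⟩
    obtain ⟨Λ, hΛ, hΛS⟩ := exists_finset_wt d hn hℓ hnℓ
    refine ⟨Λ, hΛ, fun S hS => ?_⟩
    have hTn : n / (D * ℓ ^ d) ≤ n := by
      refine div_le_self hn.le (one_le_mul_of_one_le_of_one_le ?_ (one_le_pow₀ hℓ))
      exact one_le_pow₀ one_le_two
    refine (h K hK.le c hc _ ℓ (by positivity) hℓ (hTn.trans hnℓ) S (hΛS S hS)).trans_eq ?_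
    have h1 : (n / (D * ℓ ^ d)) ^ (-(r + 1 / θ.toReal - 1)) = D⁻¹ ^ (-(r + 1 / θ.toReal - 1)) *
        (n ^ (-(r + 1 / θ.toReal - 1)) * ℓ ^ (d * (r + 1 / θ.toReal - 1))) := by
      rw [show n / (D * ℓ ^ d) = D⁻¹ * (n * (ℓ ^ d)⁻¹) by field_simp,
        Real.mul_rpow (by positivity) (by positivity), Real.mul_rpow hn.le (by positivity),
        Real.inv_rpow (x := ℓ ^ d) (by positivity), ← Real.rpow_neg (by positivity), neg_neg,
        ← Real.rpow_natCast ℓ d, ← Real.rpow_mul (by positivity)]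
    have h2 : ℓ ^ (d * r) =
        ℓ ^ (d * (r + 1 / θ.toReal - 1)) * ℓ ^ (d * (1 - 1 / θ.toReal)) := by
      rw [← Real.rpow_add (by positivity)]
      ring_nf
    rw [h1, h2]
    ring
  · refine ⟨K * ((2 * D)⁻¹ ^ (-r) * 2⁻¹ ^ (1 - 1 / θ.toReal)), by positivity,
      fun c hc n ℓ hn hℓ hnℓ => ?_⟩
    classical
    obtain ⟨Λ, hΛ, hΛS⟩ := exists_finset_wt d (half_pos hn) hℓ ((half_le_self hn.le).trans hnℓ)
    obtain ⟨Λ', hΛ', hΛS'⟩ := hc.exists_sparse hK hθ0 hθ (half_pos hn)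
    refine ⟨Λ ∪ Λ', ?_, fun S hS => ?_⟩
    · have : ((Λ ∪ Λ').card : ℝ) ≤ Λ.card + Λ'.card := by exact_mod_cast Finset.card_union_le _ _
      linarith
    · rw [Finset.disjoint_union_right] at hS
      refine (sum_wt_inv_le hr0.le (by positivity) hc.1 fun k hk => (hΛS S hS.1 k hk).le).trans ?_
      refine (mul_le_mul_of_nonneg_left (hΛS' S hS.2) (by positivity)).trans_eq ?_
      rw [show n / 2 / (2 ^ (2 * d + 1) * ℓ ^ d) = (2 * D)⁻¹ * (n * (ℓ ^ d)⁻¹) by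
          rw [← hD]; field_simp,
        Real.mul_rpow (by positivity) (by positivity), Real.mul_rpow hn.le (by positivity),
        Real.inv_rpow (x := ℓ ^ d) (by positivity), ← Real.rpow_neg (by positivity), neg_neg,
        ← Real.rpow_natCast ℓ d, ← Real.rpow_mul (by positivity), div_eq_mul_inv n 2,
        Real.mul_rpow hn.le (by positivity),
        show -(r + 1 / θ.toReal - 1) = -r + (1 - 1 / θ.toReal) by ring, Real.rpow_add hn]
      ring

/-- The tail of a weighted sequence outside a box. -/
theorem exists_box_bound (d : ℕ) (hθ0 : 0 < θ) {r : ℝ} (hr0 : 0 < r)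
    (hr : 1 - 1 / θ.toReal < r) (hK : 0 < K) :
    ∃ C η : ℝ, 0 < C ∧ 0 < η ∧ ∀ c : (Fin (d + 1) → ℤ) → ℝ,
      SeqBound θ K (fun k => wt (d + 1) k ^ r * c k) → ∀ M : ℝ, 1 ≤ M →
      ∀ S : Finset (Fin (d + 1) → ℤ), (∀ k ∈ S, M < wt (d + 1) k) →
      ∑ k ∈ S, c k ≤ C * M ^ (-η) := by
  rcases lt_or_ge 1 θ with hθ | hθ
  · obtain ⟨C, hC, h⟩ := exists_tail_bound d hθ hr
    set δ := r + 1 / θ.toReal - 1 with hδ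
    have hδ0 : 0 < δ := by linarith
    have hs1 : 1 - 1 / θ.toReal ≤ 1 := by
      have : 0 ≤ 1 / θ.toReal := by positivity
      linarith
    set ε := δ / (2 * (d + 1)) with hε
    have hε0 : 0 < ε := by positivity
    set B := 1 + 1 / (ε * Real.log 2) with hB
    have hlog2 : 0 < Real.log 2 := Real.log_pos one_lt_two
    have hB1 : 1 ≤ B := by
      have : 0 ≤ 1 / (ε * Real.log 2) := by positivity
      linarith
    refine ⟨K * (C * B ^ d), δ / 2, by positivity, by positivity, fun c hc M hM S hS => ?_⟩
    have hM0 : 0 < M := by linarith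
    have hMε : 1 ≤ M ^ ε := Real.one_le_rpow hM hε0.le
    have hℓ : 1 ≤ B * M ^ ε := one_le_mul_of_one_le_of_one_le hB1 hMε
    have hMℓ : M ≤ 2 ^ (B * M ^ ε) := by
      rw [← Real.log_le_log_iff hM0 (by positivity), Real.log_rpow two_pos]
      have h1 := Real.log_le_rpow_div hM0.le hε0
      have h2 : M ^ ε / ε = 1 / (ε * Real.log 2) * M ^ ε * Real.log 2 := by field_simp
      rw [h2] at h1
      refine h1.trans ?_
      gcongr
      linarith
    refine (h K hK.le c hc M _ hM0 hℓ hMℓ S hS).trans ?_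
    rw [mul_assoc, mul_assoc]
    refine mul_le_mul_of_nonneg_left (mul_le_mul_of_nonneg_left ?_ hC.le) hK.le
    calc M ^ (-δ) * (B * M ^ ε) ^ (d * (1 - 1 / θ.toReal)) ≤ M ^ (-δ) * (B * M ^ ε) ^ (d : ℝ) := by
          gcongr
          exact mul_le_of_le_one_right (by positivity) hs1
      _ = B ^ d * M ^ (-δ + ε * d) := by
          rw [Real.rpow_natCast, mul_pow, ← Real.rpow_natCast (M ^ ε), ← Real.rpow_mul hM0.le,
            Real.rpow_add hM0]
          ring
      _ ≤ B ^ d * M ^ (-(δ / 2)) := by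
          gcongr
          have : ε * (d + 1) = δ / 2 := by rw [hε]; field_simp
          linarith
  · refine ⟨K * 2⁻¹ ^ (1 - 1 / θ.toReal), r, by positivity, hr0, fun c hc M hM S hS => ?_⟩
    obtain ⟨Λ, hΛ, hΛS⟩ := hc.exists_sparse hK hθ0 hθ (n := 2⁻¹) (by positivity)
    have hΛ0 : Λ = ∅ := by
      rw [← Finset.card_eq_zero, ← Nat.lt_one_iff]
      have h1 : (Λ.card : ℝ) < 1 := hΛ.trans_lt (by norm_num)
      exact_mod_cast h1
    subst hΛ0
    refine (sum_wt_inv_le hr0.le (by positivity) hc.1 fun k hk => (hS k hk).le).trans ?_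
    rw [mul_comm (K * _)]
    exact mul_le_mul_of_nonneg_left (hΛS S (Finset.disjoint_empty_right _)) (by positivity)

end Sequences

section Recovery

/-- The frequencies in `[-M,M]^d`. -/
def boxFreq (d M : ℕ) : Finset (Fin d → ℤ) :=
  Fintype.piFinset fun _ => Finset.Icc (-(M : ℤ)) M

theorem mem_boxFreq {d M : ℕ} {k : Fin d → ℤ} : k ∈ boxFreq d M ↔ ∀ i, |k i| ≤ (M : ℤ) := by
  simp [boxFreq, abs_le]

theorem card_boxFreq (d M : ℕ) : (boxFreq d M).card = (2 * M + 1) ^ d := by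
  rw [boxFreq, Fintype.card_piFinset_const, Int.card_Icc]
  congr 1
  omega

theorem lt_wt_of_notMem_boxFreq {d M : ℕ} {k : Fin d → ℤ} (hk : k ∉ boxFreq d M) :
    (M : ℝ) < wt d k := by
  rw [mem_boxFreq] at hk
  push Not at hk
  obtain ⟨i, hi⟩ := hk
  have h1 : (M : ℝ) < |(k i : ℝ)| := by exact_mod_cast hi
  linarith [one_add_abs_le_wt k i]

/-- Sampling points at which every polynomial with frequencies in a box is controlled in `L₂`,
up to the `ℓ₁` norm of its coefficients. -/
theorem exists_box_points (d : ℕ) {M : ℕ} {A : ℝ} (hA : 0 < A) {L : ℕ} (hL : 0 < L)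
    (hAL : A < 2 ^ L / 2) {m : ℕ} {Q : ℝ} (hQ1 : 1 ≤ Q)
    (hQ : Real.log (4 * (2 * M + 1) ^ d + 1) ≤ Q) (hQL : Real.log L ≤ Q)
    (hm : 22000 * L * A ^ 2 * Q ^ 2 ≤ m) :
    ∃ t : Fin m → Fin d → ℝ, (∀ i, t i ∈ cube d) ∧ ∀ (a : (Fin d → ℤ) → ℂ) (ε : ℝ), 0 ≤ ε →
      (∀ i, ‖∑ k ∈ boxFreq d M, a k * expk d k (t i)‖ ≤ ε) →
      √(∑ k ∈ boxFreq d M, ‖a k‖ ^ 2) ≤ (∑ k ∈ boxFreq d M, ‖a k‖) / A + 4 * ε := by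
  have hcard : (Fintype.card (Fin d → Fin (2 * M + 1)) : ℝ) = (2 * M + 1) ^ d := by simp
  obtain ⟨t, ht⟩ := exists_sampling_points (J := boxFreq d M) (X := Fin d → Fin (2 * M + 1))
    (e := fun k g => expk d k (gridPoint d (2 * M + 1) g)) (fun k x => (norm_expk _ _ _).le)
    hA hL hAL hQ1
    (by
      rw [hcard]
      exact (Real.log_le_log (by positivity) (by linarith)).trans hQ)
    (by
      rw [Fintype.card_coe, card_boxFreq]
      exact_mod_cast hQ) hQL hm
  refine ⟨fun i => gridPoint d (2 * M + 1) (t i), fun i => gridPoint_mem_cube _ _ (t i), ?_⟩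
  intro a ε hε haε
  set N := √(∑ k ∈ boxFreq d M, ‖a k‖ ^ 2) with hN
  by_contra! hlt
  have hsum0 : 0 ≤ ∑ k ∈ boxFreq d M, ‖a k‖ := Finset.sum_nonneg fun _ _ => norm_nonneg _
  have hNpos : 0 < N := lt_of_le_of_lt (by positivity) hlt
  have hNsq : N ^ 2 = ∑ k ∈ boxFreq d M, ‖a k‖ ^ 2 :=
    Real.sq_sqrt (Finset.sum_nonneg fun _ _ => sq_nonneg _)
  have hNn : ‖(N : ℂ)‖ = N := by rw [Complex.norm_real, Real.norm_of_nonneg hNpos.le]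
  obtain ⟨i, hi⟩ := ht (fun k => a k / N)
    (by
      rw [Finset.sum_coe_sort (boxFreq d M) fun k => ‖a k / N‖]
      simp_rw [norm_div, hNn]
      rw [← Finset.sum_div, div_le_iff₀ hNpos]
      have h1 : (∑ k ∈ boxFreq d M, ‖a k‖) / A ≤ N := by linarith
      rw [div_le_iff₀ hA] at h1
      linarith)
    (by
      have h1 := sum_normSq_grid (boxFreq d M) (fun k hk => mem_boxFreq.1 hk) fun k => a k / N
      rw [hcard]
      refine le_of_eq ?_
      trans (2 * M + 1 : ℝ) ^ d * ∑ k ∈ boxFreq d M, ‖a k / N‖ ^ 2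
      · simp_rw [norm_div, hNn, div_pow]
        rw [← Finset.sum_div, ← hNsq, div_self (by positivity), mul_one]
      · rw [← h1]
        refine Finset.sum_congr rfl fun g _ => ?_
        rw [Finset.sum_coe_sort (boxFreq d M)
          fun k => a k / N * expk d k (gridPoint d (2 * M + 1) g)])
  rw [Finset.sum_coe_sort (boxFreq d M)
    fun k => a k / N * expk d k (gridPoint d (2 * M + 1) (t i))] at hi
  simp_rw [div_mul_eq_mul_div] at hi
  rw [← Finset.sum_div, norm_div, hNn, le_div_iff₀ hNpos] at hi
  have h2 := haε i
  have h3 : 0 ≤ (∑ k ∈ boxFreq d M, ‖a k‖) / A := by positivity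
  linarith

theorem LqNorm_le {d : ℕ} {q : ℝ≥0∞} (hq : 2 ≤ q) {h : (Fin d → ℝ) → ℂ} (hc : Continuous h)
    {D n : ℝ} (hD : 0 < D) (hn : 0 < n) (hB : ∀ x ∈ cube d, ‖h x‖ ≤ D * √n)
    (h2 : ∫ x in cube d, ‖h x‖ ^ 2 ≤ D ^ 2) :
    LqNorm d q h ≤ ENNReal.ofReal (D * n ^ (1 / 2 - 1 / q.toReal)) := by
  have hB' : ∀ᵐ x ∂volume.restrict (cube d), ‖h x‖ ≤ D * √n :=
    ae_restrict_of_forall_mem (measurableSet_cube d) hB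
  by_cases hqt : q = ∞
  · subst hqt
    rw [LqNorm, eLpNorm_exponent_top]
    refine (eLpNormEssSup_le_of_ae_bound hB').trans_eq ?_
    simp [Real.sqrt_eq_rpow]
  have ht2 : 2 ≤ q.toReal := by simpa using ENNReal.toReal_mono hqt hq
  have hq0 : q ≠ 0 := (two_pos.trans_le hq).ne'
  rw [LqNorm, eLpNorm_eq_lintegral_rpow_enorm_toReal hq0 hqt]
  set p := q.toReal
  have hp0 : 0 < p := by linarith
  have hint : Integrable (fun x => ‖h x‖ ^ 2) (volume.restrict (cube d)) := by
    have : IntegrableOn (fun x => ‖h x‖ ^ 2) (Set.Icc 0 1) (volume : Measure (Fin d → ℝ)) :=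
      ((hc.norm.pow 2).continuousOn).integrableOn_compact isCompact_Icc
    exact this.mono_set (cube_subset_Icc d)
  have h3 : ∫⁻ x in cube d, ‖h x‖ₑ ^ p ≤
      ENNReal.ofReal ((D * √n) ^ (p - 2)) * ENNReal.ofReal (D ^ 2) := by
    calc _ ≤ ∫⁻ x in cube d, ENNReal.ofReal ((D * √n) ^ (p - 2)) * ENNReal.ofReal (‖h x‖ ^ 2) := by
          refine lintegral_mono_ae ?_
          filter_upwards [hB'] with x hx
          rw [← ofReal_norm, ENNReal.ofReal_rpow_of_nonneg (norm_nonneg _) hp0.le,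
            ← ENNReal.ofReal_mul (by positivity)]
          refine ENNReal.ofReal_le_ofReal ?_
          rcases (norm_nonneg (h x)).eq_or_lt with h0 | h0
          · rw [← h0, Real.zero_rpow hp0.ne']; positivity
          · calc ‖h x‖ ^ p = ‖h x‖ ^ (p - 2) * ‖h x‖ ^ 2 := by
                  rw [← Real.rpow_natCast, ← Real.rpow_add h0]; simp
              _ ≤ _ := by gcongr
      _ = ENNReal.ofReal ((D * √n) ^ (p - 2)) * ENNReal.ofReal (∫ x in cube d, ‖h x‖ ^ 2) := by
          rw [lintegral_const_mul' _ _ ENNReal.ofReal_ne_top,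
            ofReal_integral_eq_lintegral_ofReal hint (Filter.Eventually.of_forall fun x => by
              positivity)]
      _ ≤ _ := by gcongr
  refine (ENNReal.rpow_le_rpow h3 (by positivity)).trans_eq ?_
  rw [← ENNReal.ofReal_mul (by positivity), ENNReal.ofReal_rpow_of_pos (by positivity)]
  congr 1
  rw [Real.mul_rpow hD.le (by positivity), mul_right_comm,
    Real.mul_rpow (by positivity) (by positivity), ← Real.rpow_natCast D 2,
    ← Real.rpow_add hD, ← Real.rpow_mul hD.le, Real.sqrt_eq_rpow, ← Real.rpow_mul hn.le,
    ← Real.rpow_mul hn.le]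
  have e1 : (p - 2 + (2 : ℕ)) * (1 / p) = 1 := by push_cast; field_simp; ring
  have e2 : 1 / 2 * (p - 2) * (1 / p) = 1 / 2 - 1 / p := by field_simp
  rw [e1, e2, Real.rpow_one]

/-- Recovery bounds for a function that vanishes at good sampling points. -/
theorem recovery_bounds {d M m : ℕ} {t : Fin m → Fin d → ℝ} (ht : ∀ i, t i ∈ cube d) {n : ℝ}
    (hn : 0 < n)
    (htb : ∀ (a : (Fin d → ℤ) → ℂ) (ε : ℝ), 0 ≤ ε →
      (∀ i, ‖∑ k ∈ boxFreq d M, a k * expk d k (t i)‖ ≤ ε) →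
      √(∑ k ∈ boxFreq d M, ‖a k‖ ^ 2) ≤ (∑ k ∈ boxFreq d M, ‖a k‖) / √n + 4 * ε)
    {h : (Fin d → ℝ) → ℂ} (hc : Continuous h) (h0 : ∀ i, h (t i) = 0) {τ : ℝ} (hτ : 0 ≤ τ)
    {Λ : Finset (Fin d → ℤ)} (hΛ : (Λ.card : ℝ) ≤ n / 4)
    (hΛτ : ∀ S, Disjoint S Λ → ∑ k ∈ S, ‖fCoeff d h k‖ ≤ τ * √n)
    (hbox : ∀ S, Disjoint S (boxFreq d M) → ∑ k ∈ S, ‖fCoeff d h k‖ ≤ min τ (τ * √n)) :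
    (∀ x ∈ cube d, ‖h x‖ ≤ 11 * τ * √n) ∧ ∫ x in cube d, ‖h x‖ ^ 2 ≤ (11 * τ) ^ 2 := by
  classical
  set c := fCoeff d h with hcdef
  set J := boxFreq d M with hJ
  have hsn : 0 < √n := Real.sqrt_pos.2 hn
  set N := √(∑ k ∈ J, ‖c k‖ ^ 2) with hN
  have hN0 : 0 ≤ N := Real.sqrt_nonneg _
  have hNsq : N ^ 2 = ∑ k ∈ J, ‖c k‖ ^ 2 :=
    Real.sq_sqrt (Finset.sum_nonneg fun _ _ => sq_nonneg _)
  have hsumJ : ∑ k ∈ J, ‖c k‖ ≤ √n / 2 * N + τ * √n := by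
    rw [← Finset.sum_inter_add_sum_sdiff J Λ]
    refine add_le_add ?_ (hΛτ _ Finset.sdiff_disjoint)
    refine abs_le_of_sq_le_sq' ?_ (by positivity) |>.2
    calc (∑ k ∈ J ∩ Λ, ‖c k‖) ^ 2 ≤ (J ∩ Λ).card * ∑ k ∈ J ∩ Λ, ‖c k‖ ^ 2 :=
          sq_sum_le_card_mul_sum_sq
      _ ≤ n / 4 * ∑ k ∈ J, ‖c k‖ ^ 2 := by
          gcongr
          · refine le_trans ?_ hΛ
            exact_mod_cast Finset.card_le_card Finset.inter_subset_right
          · exact Finset.inter_subset_left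
      _ = (√n / 2 * N) ^ 2 := by
          rw [← hNsq, mul_pow, div_pow, Real.sq_sqrt hn.le]; norm_num
  have htot : ∀ S : Finset (Fin d → ℤ), ∑ k ∈ S \ J, ‖c k‖ ≤ min τ (τ * √n) := fun S =>
    hbox _ Finset.sdiff_disjoint
  have hS : ∀ S : Finset (Fin d → ℤ), ∑ k ∈ S, ‖c k‖ ≤ √n / 2 * N + τ * √n + τ * √n := by
    intro S
    rw [← Finset.sum_inter_add_sum_sdiff S J]
    refine add_le_add (le_trans ?_ hsumJ) ((htot S).trans (min_le_right _ _))
    exact Finset.sum_le_sum_of_subset_of_nonneg Finset.inter_subset_right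
      fun _ _ _ => norm_nonneg _
  have hsummable : Summable fun k => ‖c k‖ :=
    summable_of_sum_le (fun k => norm_nonneg _) hS
  have hJt : ∀ i, ‖∑ k ∈ J, c k * expk d k (t i)‖ ≤ τ := by
    intro i
    have h1 := hasSum_fCoeff d hc hsummable (ht i)
    rw [h0 i] at h1
    refine le_of_tendsto (x := Filter.atTop) (f := fun S : Finset (Fin d → ℤ) =>
      ‖∑ k ∈ J, c k * expk d k (t i) - ∑ k ∈ S, c k * expk d k (t i)‖) ?_ ?_
    · simpa using (tendsto_const_nhds.sub h1).norm
    · filter_upwards [Filter.eventually_ge_atTop J] with S hJS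
      rw [← Finset.sum_sdiff hJS, sub_add_cancel_right, norm_neg]
      refine (norm_sum_le _ _).trans (le_trans ?_ ((htot S).trans (min_le_left _ _)))
      refine Finset.sum_le_sum fun k _ => ?_
      rw [norm_mul, norm_expk, mul_one]
  have hNτ : N ≤ 10 * τ := by
    have h1 := htb c τ hτ hJt
    have h2 : (∑ k ∈ J, ‖c k‖) / √n ≤ N / 2 + τ := by
      rw [div_le_iff₀ hsn]
      linarith
    linarith
  constructor
  · intro x hx
    have h1 := (hasSum_fCoeff d hc hsummable hx).norm_le_of_bounded hsummable.hasSum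
      (fun k => by rw [norm_mul, norm_expk, mul_one])
    refine h1.trans ((Summable.tsum_le_of_sum_le hsummable hS).trans ?_)
    nlinarith [mul_nonneg hτ hsn.le]
  · have h1 := hasSum_sq_fCoeff d hc
    refine hasSum_le_of_sum_le h1 fun S => ?_
    rw [← Finset.sum_inter_add_sum_sdiff S J]
    have h2 : ∑ k ∈ S ∩ J, ‖c k‖ ^ 2 ≤ N ^ 2 := by
      rw [hNsq]
      exact Finset.sum_le_sum_of_subset_of_nonneg Finset.inter_subset_right
        fun _ _ _ => sq_nonneg _
    have h3 : ∑ k ∈ S \ J, ‖c k‖ ^ 2 ≤ (∑ k ∈ S \ J, ‖c k‖) ^ 2 :=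
      Finset.sum_sq_le_sq_sum_of_nonneg fun _ _ => norm_nonneg _
    have h4 : (∑ k ∈ S \ J, ‖c k‖) ^ 2 ≤ τ ^ 2 :=
      pow_le_pow_left₀ (Finset.sum_nonneg fun _ _ => norm_nonneg _)
        ((htot S).trans (min_le_left _ _)) 2
    nlinarith

theorem fCoeff_sub {d : ℕ} {f g : (Fin d → ℝ) → ℂ} (hf : Continuous f) (hg : Continuous g)
    (k : Fin d → ℤ) : fCoeff d (f - g) k = fCoeff d f k - fCoeff d g k := by
  have hi : ∀ {u : (Fin d → ℝ) → ℂ}, Continuous u →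
      IntegrableOn (fun x => u x * expk d (-k) x) (cube d) := fun {u} hu => by
    have hE : Continuous (expk d (-k)) := by unfold expk; fun_prop
    exact ((hu.mul hE).continuousOn.integrableOn_compact isCompact_Icc).mono_set
      (cube_subset_Icc d)
  rw [fCoeff, fCoeff, fCoeff, ← integral_sub (hi hf) (hi hg)]
  simp only [Pi.sub_apply, sub_mul]

theorem seqBound_of_wienerNorm_le {d : ℕ} {r : ℝ} {θ : ℝ≥0∞} (hθ : 0 < θ)
    {f : (Fin d → ℝ) → ℂ} (hf : wienerNorm d r θ f ≤ 1) :
    SeqBound θ 1 fun k => wt d k ^ r * ‖fCoeff d f k‖ := by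
  have hw : ∀ k, 0 ≤ wt d k ^ r := fun k =>
    Real.rpow_nonneg (zero_le_one.trans (one_le_wt d k)) r
  have hof : ∀ k, ENNReal.ofReal (wt d k ^ r) * (‖fCoeff d f k‖₊ : ℝ≥0∞) =
      ENNReal.ofReal (wt d k ^ r * ‖fCoeff d f k‖) := fun k => by
    rw [ENNReal.ofReal_mul (hw k), ofReal_norm, enorm_eq_nnnorm]
  rw [wienerNorm] at hf
  simp only [hof] at hf
  refine ⟨fun k => mul_nonneg (hw k) (norm_nonneg _), fun hθt k => ?_, fun hθt S => ?_⟩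
  · rw [if_pos hθt] at hf
    have := (le_iSup _ k).trans hf
    rwa [ENNReal.ofReal_le_one] at this
  · rw [if_neg hθt] at hf
    have ht : 0 < θ.toReal := ENNReal.toReal_pos hθ.ne' hθt
    rw [← ENNReal.one_rpow (1 / θ.toReal), ENNReal.rpow_le_rpow_iff (by positivity)] at hf
    have h1 := (ENNReal.sum_le_tsum S).trans hf
    simp only [ENNReal.ofReal_rpow_of_nonneg (mul_nonneg (hw _) (norm_nonneg _)) ht.le] at h1
    rw [← ENNReal.ofReal_sum_of_nonneg fun k _ =>
      Real.rpow_nonneg (mul_nonneg (hw _) (norm_nonneg _)) _, ENNReal.ofReal_le_one] at h1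
    rwa [Real.one_rpow]

theorem SeqBound.of_le_add {ι : Type*} {θ : ℝ≥0∞} (hθ : 0 < θ) {a b c : ι → ℝ}
    (ha : SeqBound θ 1 a) (hb : SeqBound θ 1 b) (hc : ∀ k, 0 ≤ c k)
    (habc : ∀ k, c k ≤ a k + b k) : SeqBound θ (2 * 2 ^ (1 / θ.toReal)) c := by
  refine ⟨hc, fun hθt k => ?_, fun hθt S => ?_⟩
  · have h1 := ha.2.1 hθt k
    have h2 := hb.2.1 hθt k
    have h3 := habc k
    simp only [hθt, ENNReal.toReal_top]
    linarith
  · have ht : 0 < θ.toReal := ENNReal.toReal_pos hθ.ne' hθt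
    have h1 := ha.2.2 hθt S
    have h2 := hb.2.2 hθt S
    rw [Real.one_rpow] at h1 h2
    have h3 : ∀ k ∈ S, c k ^ θ.toReal ≤ 2 ^ θ.toReal * (a k ^ θ.toReal + b k ^ θ.toReal) := by
      intro k _
      have ha0 := Real.rpow_nonneg (ha.1 k) θ.toReal
      have hb0 := Real.rpow_nonneg (hb.1 k) θ.toReal
      have h4 : c k ≤ 2 * max (a k) (b k) := by
        linarith [habc k, le_max_left (a k) (b k), le_max_right (a k) (b k)]
      refine (Real.rpow_le_rpow (hc k) h4 ht.le).trans ?_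
      rw [Real.mul_rpow two_pos.le ((ha.1 k).trans (le_max_left _ _))]
      gcongr
      rcases max_choice (a k) (b k) with h5 | h5 <;> rw [h5] <;> linarith
    refine (Finset.sum_le_sum h3).trans ?_
    rw [← Finset.mul_sum, Finset.sum_add_distrib, Real.mul_rpow two_pos.le (by positivity),
      ← Real.rpow_mul two_pos.le, one_div_mul_cancel ht.ne', Real.rpow_one]
    gcongr
    linarith

theorem one_le_logStar (m : ℕ) : 1 ≤ logStar m := le_max_right _ _

theorem le_two_rpow_logStar {m : ℕ} (hm : 1 ≤ m) : (m : ℝ) ≤ 2 ^ logStar m := by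
  have hm0 : (0 : ℝ) < m := by exact_mod_cast hm
  rw [← Real.logb_le_iff_le_rpow one_lt_two hm0]
  exact le_max_left _ _

theorem log_box_le (d κ : ℕ) {ℓ : ℝ} (hℓ : 1 ≤ ℓ) :
    Real.log (4 * (2 * ((2 ^ (κ * ⌈ℓ⌉₊) : ℕ) : ℝ) + 1) ^ d + 1) ≤ (3 + 2 * d + 2 * d * κ) * ℓ := by
  set M : ℝ := ((2 ^ (κ * ⌈ℓ⌉₊) : ℕ) : ℝ) with hM
  have hM2 : M = 2 ^ (κ * ⌈ℓ⌉₊) := by rw [hM]; push_cast; rfl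
  have hM1 : 1 ≤ M := by rw [hM2]; exact one_le_pow₀ one_le_two
  have h1 : 4 * (2 * M + 1) ^ d + 1 ≤ 2 ^ (3 + d * (2 + κ * ⌈ℓ⌉₊)) := by
    have h2 : (2 * M + 1) ^ d ≤ (4 * M) ^ d := by gcongr; linarith
    have h3 : 1 ≤ (4 * M) ^ d := one_le_pow₀ (by linarith)
    calc _ ≤ 8 * (4 * M) ^ d := by linarith
      _ = _ := by rw [hM2, pow_add 2 3, mul_comm d, pow_mul _ _ d, pow_add _ 2]; norm_num
  have hceil : (⌈ℓ⌉₊ : ℝ) ≤ 2 * ℓ := by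
    have := Nat.ceil_lt_add_one (zero_le_one.trans hℓ)
    linarith
  refine (Real.log_le_log (by positivity) h1).trans ?_
  rw [Real.log_pow]
  have h2 := Real.log_two_lt_d9
  have h3 := Real.log_pos one_lt_two
  calc ((3 + d * (2 + κ * ⌈ℓ⌉₊) : ℕ) : ℝ) * Real.log 2
    _ ≤ ((3 + d * (2 + κ * ⌈ℓ⌉₊) : ℕ) : ℝ) * 1 := by
        gcongr; linarith
    _ = 3 + d * 2 + d * κ * ⌈ℓ⌉₊ := by push_cast; ring
    _ ≤ 3 + d * 2 + d * κ * (2 * ℓ) := by gcongr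
    _ ≤ _ := by nlinarith [(Nat.cast_nonneg d : (0 : ℝ) ≤ d)]

theorem exists_box_points_of_le (d κ : ℕ) (hd : 1 ≤ d) {m : ℕ} {ℓ n : ℝ} (hℓ : 1 ≤ ℓ)
    (hn : 0 < n) (hnℓ : n ≤ 2 ^ ℓ)
    (hm : 88000 * (3 + 2 * d + 2 * d * κ) ^ 2 * ℓ ^ 3 * n ≤ m) :
    ∃ t : Fin m → Fin d → ℝ, (∀ i, t i ∈ cube d) ∧ ∀ (a : (Fin d → ℤ) → ℂ) (ε : ℝ), 0 ≤ ε →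
      (∀ i, ‖∑ k ∈ boxFreq d (2 ^ (κ * ⌈ℓ⌉₊)), a k * expk d k (t i)‖ ≤ ε) →
      √(∑ k ∈ boxFreq d (2 ^ (κ * ⌈ℓ⌉₊)), ‖a k‖ ^ 2) ≤
        (∑ k ∈ boxFreq d (2 ^ (κ * ⌈ℓ⌉₊)), ‖a k‖) / √n + 4 * ε := by
  have hd1 : (1 : ℝ) ≤ d := by exact_mod_cast hd
  have hκ : (0 : ℝ) ≤ d * κ := by positivity
  have hceil := Nat.ceil_lt_add_one (zero_le_one.trans hℓ)
  have hL : ((⌈ℓ⌉₊ + 2 : ℕ) : ℝ) ≤ 4 * ℓ := by push_cast; linarith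
  have hQ : 4 * ℓ ≤ (3 + 2 * d + 2 * d * κ) * ℓ := by gcongr; linarith
  refine exists_box_points d (Real.sqrt_pos.2 hn) (L := ⌈ℓ⌉₊ + 2) (by omega) ?_
    (Q := (3 + 2 * d + 2 * d * κ) * ℓ) (by linarith) (log_box_le d κ hℓ) ?_ ?_
  · have h1 : √n ≤ 2 ^ ℓ := by
      refine (Real.sqrt_le_sqrt hnℓ).trans (Real.sqrt_le_self_iff.2 ?_)
      exact Or.inr (Real.one_le_rpow one_le_two (by linarith))
    have h2 : (2 : ℝ) ^ ℓ ≤ 2 ^ ⌈ℓ⌉₊ := by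
      rw [← Real.rpow_natCast]
      exact Real.rpow_le_rpow_of_exponent_le one_le_two (Nat.le_ceil ℓ)
    have h3 : (0 : ℝ) < 2 ^ ⌈ℓ⌉₊ := by positivity
    rw [pow_add]
    linarith
  · have h1 := Real.log_le_sub_one_of_pos (x := ((⌈ℓ⌉₊ + 2 : ℕ) : ℝ)) (by positivity)
    linarith
  · rw [Real.sq_sqrt hn.le]
    refine le_trans ?_ hm
    calc 22000 * ((⌈ℓ⌉₊ + 2 : ℕ) : ℝ) * n * ((3 + 2 * d + 2 * d * κ) * ℓ) ^ 2
        ≤ 22000 * (4 * ℓ) * n * ((3 + 2 * d + 2 * d * κ) * ℓ) ^ 2 := by gcongr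
      _ = _ := by ring

theorem exists_recovery_points (d : ℕ) {θ q : ℝ≥0∞} (hθ : 0 < θ) (hq : 2 ≤ q) {r : ℝ}
    (hr0 : 0 < r) (hr : 1 - 1 / θ.toReal < r) {K : ℝ} (hK : 0 < K) :
    ∃ C : ℝ, 0 < C ∧ ∀ m : ℕ, 1 ≤ m → ∃ t : Fin m → Fin (d + 1) → ℝ,
      (∀ i, t i ∈ cube (d + 1)) ∧ ∀ h : (Fin (d + 1) → ℝ) → ℂ, Continuous h →
      SeqBound θ K (fun k => wt (d + 1) k ^ r * ‖fCoeff (d + 1) h k‖) → (∀ i, h (t i) = 0) →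
      LqNorm (d + 1) q h ≤ ENNReal.ofReal (C * ((m : ℝ) ^ (-(r + 1 / θ.toReal + 1 / q.toReal - 1)) *
        logStar m ^ (d * r + 3 * (r + 1 / θ.toReal + 1 / q.toReal - 1)))) := by
  obtain ⟨C₁, hC₁, hsparse⟩ := exists_sparse_bound d hθ hr0 hr hK
  obtain ⟨C₂, η, hC₂, hη, hbox⟩ := exists_box_bound d hθ hr0 hr hK
  set α := r + 1 / θ.toReal - 1 with hα
  have hα0 : 0 < α := by linarith
  obtain ⟨κ, hκ⟩ := exists_nat_ge ((α + 1 / 2) / η)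
  rw [div_le_iff₀ hη] at hκ
  set q₀ : ℝ := 3 + 2 * (d + 1 : ℕ) + 2 * (d + 1 : ℕ) * κ with hq₀
  have hq₀1 : 1 ≤ q₀ := by
    have : (0 : ℝ) ≤ 2 * (d + 1 : ℕ) + 2 * (d + 1 : ℕ) * κ := by positivity
    linarith
  set b : ℝ := 88000 * q₀ ^ 2 with hb
  have hb1 : 1 ≤ b := by nlinarith
  set C₃ := C₁ * 4 ^ α + C₂ with hC₃
  have hC₃0 : 0 < C₃ := by positivity
  have hβ : r + 1 / θ.toReal + 1 / q.toReal - 1 = α + 1 / q.toReal := by ring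
  rw [hβ]
  set β := α + 1 / q.toReal with hβ'
  refine ⟨11 * C₃ * b ^ β, by positivity, fun m hm => ?_⟩
  have hm0 : (0 : ℝ) < m := by exact_mod_cast hm
  have hℓ := one_le_logStar m
  have hmℓ := le_two_rpow_logStar hm
  set ℓ := logStar m
  have hℓ0 : 0 < ℓ := by linarith
  set n : ℝ := m / (b * ℓ ^ 3) with hn
  have hn0 : 0 < n := by positivity
  have hnm : n ≤ m := div_le_self hm0.le (one_le_mul_of_one_le_of_one_le hb1 (one_le_pow₀ hℓ))
  have hnℓ : n ≤ 2 ^ ℓ := hnm.trans hmℓ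
  obtain ⟨t, ht, htb⟩ := exists_box_points_of_le (d + 1) κ (by omega) (m := m) hℓ hn0 hnℓ
    (le_of_eq (by rw [← hq₀, ← hb, hn]; field_simp))
  refine ⟨t, ht, fun h hc hseq h0 => ?_⟩
  set M := 2 ^ (κ * ⌈ℓ⌉₊) with hM
  set τ := C₃ * (n ^ (-(α + 1 / 2)) * ℓ ^ (d * r)) with hτ
  have hτ0 : 0 < τ := by positivity
  have hτn : τ * √n = C₃ * (n ^ (-α) * ℓ ^ (d * r)) := by
    rw [hτ, Real.sqrt_eq_rpow, show -α = -(α + 1 / 2) + 1 / 2 by ring, Real.rpow_add hn0]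
    ring
  have hℓdr : 1 ≤ ℓ ^ (d * r) := Real.one_le_rpow hℓ (by positivity)
  obtain ⟨Λ, hΛ, hΛS⟩ := hsparse _ hseq (n / 4) ℓ (by positivity) hℓ (by linarith)
  have hMη : ∀ x : ℝ, 0 ≤ x → x ≤ α + 1 / 2 → (M : ℝ) ^ (-η) ≤ n ^ (-x) := by
    intro x hx0 hx
    rw [Real.rpow_neg (by positivity), Real.rpow_neg hn0.le]
    refine inv_anti₀ (by positivity) ?_
    calc n ^ x ≤ (2 ^ ℓ) ^ x := by gcongr
      _ = 2 ^ (ℓ * x) := by rw [← Real.rpow_mul two_pos.le]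
      _ ≤ 2 ^ (⌈ℓ⌉₊ * (κ * η)) := by
          gcongr
          · exact one_le_two
          · exact Nat.le_ceil ℓ
          · linarith
      _ = (M : ℝ) ^ η := by
          rw [hM]
          push_cast
          rw [← Real.rpow_natCast, ← Real.rpow_mul two_pos.le]
          push_cast
          ring_nf
  have hboxS : ∀ S, Disjoint S (boxFreq (d + 1) M) → ∀ x : ℝ, 0 ≤ x → x ≤ α + 1 / 2 →
      ∑ k ∈ S, ‖fCoeff (d + 1) h k‖ ≤ C₃ * (n ^ (-x) * ℓ ^ (d * r)) := by
    intro S hS x hx0 hx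
    refine (hbox _ hseq M (by rw [hM]; push_cast; exact one_le_pow₀ one_le_two) S fun k hk =>
      lt_wt_of_notMem_boxFreq (Finset.disjoint_left.1 hS hk)).trans ?_
    gcongr
    · rw [hC₃]
      exact le_add_of_nonneg_left (by positivity)
    · exact (hMη x hx0 hx).trans (le_mul_of_one_le_right (by positivity) hℓdr)
  obtain ⟨hsup, hL2⟩ := recovery_bounds ht hn0 htb hc h0 hτ0.le hΛ
    (fun S hS => by
      refine (hΛS S hS).trans ?_
      rw [hτn, div_eq_mul_inv n 4, Real.mul_rpow hn0.le (by positivity),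
        Real.inv_rpow (by positivity), ← Real.rpow_neg (by positivity), neg_neg]
      calc _ = C₁ * 4 ^ α * (n ^ (-α) * ℓ ^ (d * r)) := by ring
        _ ≤ _ := by
            gcongr
            rw [hC₃]
            exact le_add_of_nonneg_right hC₂.le)
    (fun S hS => le_min (hboxS S hS _ (by positivity) le_rfl) (by
      rw [hτn]
      exact hboxS S hS _ hα0.le (by linarith)))
  refine (LqNorm_le hq hc (by positivity) hn0 hsup hL2).trans_eq ?_
  congr 1
  have e1 : n ^ (-β) = b ^ β * (m ^ (-β) * ℓ ^ (3 * β)) := by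
    rw [hn, show m / (b * ℓ ^ 3) = b⁻¹ * ((m : ℝ) * (ℓ ^ 3)⁻¹) by field_simp,
      Real.mul_rpow (by positivity) (by positivity), Real.mul_rpow hm0.le (by positivity),
      Real.inv_rpow (by positivity), Real.inv_rpow (by positivity),
      ← Real.rpow_neg (by positivity), ← Real.rpow_neg (by positivity), neg_neg,
      ← Real.rpow_natCast ℓ 3, ← Real.rpow_mul hℓ0.le]
    push_cast
    ring
  have e2 : n ^ (-(α + 1 / 2)) * n ^ (1 / 2 - 1 / q.toReal) = n ^ (-β) := by
    rw [← Real.rpow_add hn0, hβ']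
    ring_nf
  calc _ = 11 * C₃ * (n ^ (-(α + 1 / 2)) * n ^ (1 / 2 - 1 / q.toReal)) * ℓ ^ (d * r) := by
        rw [hτ]; ring
    _ = _ := by rw [e2, e1, Real.rpow_add hℓ0]; ring

end Recovery

/-- improved upper bound for the non-linear sampling widths
`ρ_m(S^r_θ A)_{L_q}`, valid for all `m ∈ ℕ`. -/
theorem statement13 (d : ℕ) (hd : 1 ≤ d) (θ : ℝ≥0∞) (hθ : 0 < θ) (q : ℝ≥0∞)
    (hq : 2 ≤ q) (r : ℝ) (hr : max (1 - 1/θ.toReal) 0 < r) :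
    ∃ C : ℝ, 0 < C ∧ ∀ m : ℕ, 1 ≤ m →
      samplingWidth d m (wienerNorm d r θ) q ≤
        ENNReal.ofReal (C * ((m : ℝ) ^ (-(r + 1/θ.toReal + 1/q.toReal - 1)) *
          logStar m ^ (((d : ℝ) - 1) * r + 3 * (r + 1/θ.toReal + 1/q.toReal - 1)))) := by
  obtain ⟨d, rfl⟩ := Nat.exists_eq_add_of_le' hd
  obtain ⟨hr1, hr0⟩ := max_lt_iff.1 hr
  obtain ⟨C, hC, h⟩ := exists_recovery_points d hθ hq hr0 hr1
    (K := 2 * 2 ^ (1 / θ.toReal)) (by positivity)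
  refine ⟨C, hC, fun m hm => ?_⟩
  obtain ⟨t, ht, hrec⟩ := h m hm
  classical
  let P : (Fin m → ℂ) → ((Fin (d + 1) → ℝ) → ℂ) → Prop := fun y g =>
    (Continuous g ∧ wienerNorm (d + 1) r θ g ≤ 1) ∧ ∀ i, g (t i) = y i
  refine iInf₂_le_of_le t ht (iInf_le_of_le
    (fun y => if hy : ∃ g, P y g then hy.choose else 0) (iSup₂_le fun f hf => ?_))
  have hex : ∃ g, P (fun i => f (t i)) g := ⟨f, hf, fun _ => rfl⟩
  beta_reduce
  rw [dif_pos hex]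
  obtain ⟨⟨hg, hgn⟩, hgt⟩ := hex.choose_spec
  set g := hex.choose
  have hw : ∀ k, 0 ≤ wt (d + 1) k ^ r := fun k =>
    Real.rpow_nonneg (zero_le_one.trans (one_le_wt _ k)) r
  refine (hrec (f - g) (hf.1.sub hg) ?_ fun i => ?_).trans_eq ?_
  · refine SeqBound.of_le_add hθ (seqBound_of_wienerNorm_le hθ hf.2)
      (seqBound_of_wienerNorm_le hθ hgn) (fun k => mul_nonneg (hw k) (norm_nonneg _)) fun k => ?_
    rw [fCoeff_sub hf.1 hg, ← mul_add]
    exact mul_le_mul_of_nonneg_left (norm_sub_le _ _) (hw k)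
  · rw [Pi.sub_apply, hgt i, sub_self]
  · push_cast
    rw [add_sub_cancel_right]

end Paper
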